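/- arXiv:math/0406250 — 2 statements merged into one kernel-verified Lean document; each statement's English description precedes it below -/
import Mathlib

section
/- An edgewise connected skew diagram with d diagonals has exactly 2^{d−1} outside decompositions. -/
noncomputable section

/-- A box in the plane: `(row, column)`, rows increasing downward (English notation). -/
abbrev Box : Type := ℤ × ℤ

/-- The content of a box `(i, j)` is `j - i`. -/
def boxContent (b : Box) : ℤ := b.2 - b.1

/-- An integer partition, indexed from `1` (the value `part 0` is irrelevant). -/
structure Partition' where
  part : ℕ → ℕ
  antitone : ∀ ⦃i j : ℕ⦄, i ≤ j → part j ≤ part i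
  eventually_zero : ∃ N : ℕ, ∀ i : ℕ, N ≤ i → part i = 0

/-- The skew diagram `λ/μ`: boxes `(i, j)` with `i ≥ 1` and `μ_i < j ≤ λ_i`. -/
def skewCells (lam mu : Partition') : Set Box :=
  {b : Box | 1 ≤ b.1 ∧ (mu.part b.1.toNat : ℤ) < b.2 ∧ b.2 ≤ (lam.part b.1.toNat : ℤ)}

/-- `D` is the set of boxes of a skew diagram `λ/μ` for some partitions `μ ⊆ λ`. -/
def IsSkewShape (D : Set Box) : Prop :=
  ∃ lam mu : Partition', (∀ i, mu.part i ≤ lam.part i) ∧ D = skewCells lam mu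

/-- Translate a set of boxes by a vector `v`. -/
def boxTranslate (v : Box) (D : Set Box) : Set Box := (fun b => b + v) '' D

/-- `D` is a translate of a skew diagram. -/
def IsSkewLike (D : Set Box) : Prop := ∃ v : Box, IsSkewShape (boxTranslate v D)

/-- Two boxes share a common edge. -/
def boxAdj (a b : Box) : Prop :=
  (a.1 = b.1 ∧ (a.2 = b.2 + 1 ∨ b.2 = a.2 + 1)) ∨
  (a.2 = b.2 ∧ (a.1 = b.1 + 1 ∨ b.1 = a.1 + 1))

/-- Any two boxes of `D` are joined by a path of boxes of `D` in which consecutive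
boxes share a common edge. -/
def EdgewiseConnected (D : Set Box) : Prop :=
  ∀ a ∈ D, ∀ b ∈ D, Relation.ReflTransGen (fun x y => x ∈ D ∧ y ∈ D ∧ boxAdj x y) a b

/-- `D` contains no `2 × 2` block of boxes. -/
def NoTwoByTwo (D : Set Box) : Prop :=
  ∀ b : Box, ¬(b ∈ D ∧ (b.1, b.2 + 1) ∈ D ∧ (b.1 + 1, b.2) ∈ D ∧ (b.1 + 1, b.2 + 1) ∈ D)

/-- A border strip (ribbon): a nonempty edgewise connected skew diagram (up to translation)
containing no `2 × 2` block of boxes. -/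
def IsBorderStrip (B : Set Box) : Prop :=
  B.Nonempty ∧ IsSkewLike B ∧ EdgewiseConnected B ∧ NoTwoByTwo B

/-- `b` is the starting box (lower-left end) of `B`: no box of `B` directly to its left
nor directly below it. -/
def IsStartBox (B : Set Box) (b : Box) : Prop :=
  b ∈ B ∧ (b.1, b.2 - 1) ∉ B ∧ (b.1 + 1, b.2) ∉ B

/-- `b` is the ending box (upper-right end) of `B`: no box of `B` directly above it
nor directly to its right. -/
def IsEndBox (B : Set Box) (b : Box) : Prop :=
  b ∈ B ∧ (b.1 - 1, b.2) ∉ B ∧ (b.1, b.2 + 1) ∉ B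

/-- The strip `B` has starting box of content `p` and ending box of content `q`. -/
def HasPQ (B : Set Box) (p q : ℤ) : Prop :=
  (∃ b : Box, IsStartBox B b ∧ boxContent b = p) ∧
  (∃ b : Box, IsEndBox B b ∧ boxContent b = q)

/-- An outside decomposition of `D`: a partition of the boxes of `D` into pairwise disjoint
border strips, each strip having its starting box on the left or bottom perimeter of `D` and
its ending box on the right or top perimeter of `D`. -/
def IsOutsideDecomposition (D : Set Box) (P : Set (Set Box)) : Prop :=
  (∀ θ ∈ P, IsBorderStrip θ ∧ θ ⊆ D) ∧
  (∀ b ∈ D, ∃! θ : Set Box, θ ∈ P ∧ b ∈ θ) ∧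
  (∀ θ ∈ P, ∀ b : Box, IsStartBox θ b → ((b.1, b.2 - 1) ∉ D ∨ (b.1 + 1, b.2) ∉ D)) ∧
  (∀ θ ∈ P, ∀ b : Box, IsEndBox θ b → ((b.1 - 1, b.2) ∉ D ∨ (b.1, b.2 + 1) ∉ D))

/-- The box `b` of `D` goes up in the outside decomposition `P`: in the strip of `P`
containing it, the next box is directly above it; an ending box goes up when no box of `D`
lies directly above it. -/
def GoesUp (D : Set Box) (P : Set (Set Box)) (b : Box) : Prop :=
  ∃ θ ∈ P, b ∈ θ ∧ ((b.1 - 1, b.2) ∈ θ ∨ (IsEndBox θ b ∧ (b.1 - 1, b.2) ∉ D))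

/-- The box `b` of `D` goes right in the outside decomposition `P`: in the strip of `P`
containing it, the next box is directly to its right; an ending box goes right when some box
of `D` lies directly above it. -/
def GoesRight (D : Set Box) (P : Set (Set Box)) (b : Box) : Prop :=
  ∃ θ ∈ P, b ∈ θ ∧ ((b.1, b.2 + 1) ∈ θ ∨ (IsEndBox θ b ∧ (b.1 - 1, b.2) ∈ D))

/-- `T` is a cutting strip of the outside decomposition `P` of `D`: a border strip whose
boxes are labeled by the contents of `D` (each content appearing once), in which the box
labeled `c` goes up or goes right according as the boxes of the diagonal of content `c`
of `D` go up or go right in `P`. -/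
def IsCuttingStripOf (D : Set Box) (P : Set (Set Box)) (T : Set Box) : Prop :=
  IsBorderStrip T ∧ boxContent '' T = boxContent '' D ∧
  ∀ b ∈ T, ∀ c ∈ D, boxContent c = boxContent b →
    (((b.1 - 1, b.2) ∈ T → GoesUp D P c) ∧ ((b.1, b.2 + 1) ∈ T → GoesRight D P c))

/-- The segment `φ[p, q]` of a strip `T`: its boxes of content between `p` and `q`. -/
def stripSegment (T : Set Box) (p q : ℤ) : Set Box :=
  {b ∈ T | p ≤ boxContent b ∧ boxContent b ≤ q}

/-- The box of content `c` of the strip `T` goes up (the next box is directly above it). -/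
def StripGoesUpAt (T : Set Box) (c : ℤ) : Prop :=
  ∃ b ∈ T, boxContent b = c ∧ (b.1 - 1, b.2) ∈ T

/-- The box of content `c` of the strip `T` goes right (the next box is directly right of it). -/
def StripGoesRightAt (T : Set Box) (c : ℤ) : Prop :=
  ∃ b ∈ T, boxContent b = c ∧ (b.1, b.2 + 1) ∈ T

/-- `T'` is obtained from the strip `T` by reversing the direction (up versus right) of the
box labeled `i`, keeping the directions of all other boxes. -/
def IsTwist (i : ℤ) (T T' : Set Box) : Prop :=
  boxContent '' T' = boxContent '' T ∧
  (∀ c : ℤ, c ≠ i → (StripGoesUpAt T c ↔ StripGoesUpAt T' c)) ∧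
  (StripGoesUpAt T i ↔ StripGoesRightAt T' i)

/-- The inversion number of an outside decomposition: the number of ordered pairs of
strips `(θ₁, θ₂)` with `p(θ₁) > p(θ₂)` and `q(θ₁) < q(θ₂)`. -/
def invOD (P : Set (Set Box)) : ℕ :=
  {θθ : Set Box × Set Box | θθ.1 ∈ P ∧ θθ.2 ∈ P ∧
    ∃ p₁ q₁ p₂ q₂ : ℤ, HasPQ θθ.1 p₁ q₁ ∧ HasPQ θθ.2 p₂ q₂ ∧ p₂ < p₁ ∧ q₁ < q₂}.ncard

/-- A semistandard Young tableau of shape `D`: entries (variable indices) weakly increase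
along rows and strictly increase down columns; entries outside `D` are normalized to `0`. -/
def IsSSYT (D : Set Box) (T : Box → ℕ) : Prop :=
  (∀ b ∈ D, (b.1, b.2 + 1) ∈ D → T b ≤ T (b.1, b.2 + 1)) ∧
  (∀ b ∈ D, (b.1 + 1, b.2) ∈ D → T b < T (b.1 + 1, b.2)) ∧
  (∀ b : Box, b ∉ D → T b = 0)

/-- The skew Schur function of a skew diagram `D`, as a formal power series in the
variables `x_n` (`n : ℕ`): the coefficient of a monomial `μ` is the number of semistandard
Young tableaux of shape `D` using each variable `n` exactly `μ n` times. -/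
def schur (D : Set Box) : MvPowerSeries ℕ ℤ :=
  fun μ => ({T : Box → ℕ | IsSSYT D T ∧ ∀ n : ℕ, μ n = {b ∈ D | T b = n}.ncard}.ncard : ℤ)

/-- `b` is the upper-right corner box of `D`: the rightmost box of the top row. -/
def IsUpperRightCorner (D : Set Box) (b : Box) : Prop :=
  b ∈ D ∧ (∀ c ∈ D, b.1 ≤ c.1) ∧ ∀ c ∈ D, c.1 = b.1 → c.2 ≤ b.2

/-- `b` is the lower-left corner box of `D`: the leftmost box of the bottom row. -/
def IsLowerLeftCorner (D : Set Box) (b : Box) : Prop :=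
  b ∈ D ∧ (∀ c ∈ D, c.1 ≤ b.1) ∧ ∀ c ∈ D, c.1 = b.1 → b.2 ≤ c.2

/-- The block (edgewise connected component) of `D` containing the box `a`. -/
def blockOf (D : Set Box) (a : Box) : Set Box :=
  {b : Box | Relation.ReflTransGen (fun x y => x ∈ D ∧ y ∈ D ∧ boxAdj x y) a b}

/-- The complete homogeneous symmetric function `h_r` (`h_0 = 1`, `h_r = 0` for `r < 0`):
the sum of all monomials of degree `r`. -/
def hSym (r : ℤ) : MvPowerSeries ℕ ℤ :=
  fun μ => if ((μ.sum fun _ e => e : ℕ) : ℤ) = r then 1 else 0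

/-- The elementary symmetric function `e_r` (`e_0 = 1`, `e_r = 0` for `r < 0`):
the sum of all squarefree monomials of degree `r`. -/
def eSym (r : ℤ) : MvPowerSeries ℕ ℤ :=
  fun μ => if (∀ n ∈ μ.support, μ n = 1) ∧ ((μ.sum fun _ e => e : ℕ) : ℤ) = r then 1 else 0

/-- The `j`-th part (`j ≥ 1`) of the conjugate partition: the number of indices `i ≥ 1`
with `λ_i ≥ j`. -/
def conjPart (lam : Partition') (j : ℕ) : ℕ := {i : ℕ | 1 ≤ i ∧ j ≤ lam.part i}.ncard

/-- The order on the supersymmetric alphabet `x_0 < x_1 < ⋯ < y_0 < y_1 < ⋯`,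
with `Sum.inl n` representing `x_n` and `Sum.inr n` representing `y_n`. -/
def entryLE : ℕ ⊕ ℕ → ℕ ⊕ ℕ → Prop
  | Sum.inl a, Sum.inl b => a ≤ b
  | Sum.inl _, Sum.inr _ => True
  | Sum.inr _, Sum.inl _ => False
  | Sum.inr a, Sum.inr b => a ≤ b

/-- A super tableau of shape `D`: rows and columns weakly increase, the `x`-symbols
strictly increase down columns, the `y`-symbols strictly increase along rows; entries
outside `D` are normalized to `Sum.inl 0`. -/
def IsSuperSSYT (D : Set Box) (T : Box → ℕ ⊕ ℕ) : Prop :=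
  (∀ b ∈ D, (b.1, b.2 + 1) ∈ D → entryLE (T b) (T (b.1, b.2 + 1))) ∧
  (∀ b ∈ D, (b.1 + 1, b.2) ∈ D → entryLE (T b) (T (b.1 + 1, b.2))) ∧
  (∀ b ∈ D, (b.1 + 1, b.2) ∈ D →
    ∀ a c : ℕ, T b = Sum.inl a → T (b.1 + 1, b.2) = Sum.inl c → a < c) ∧
  (∀ b ∈ D, (b.1, b.2 + 1) ∈ D →
    ∀ a c : ℕ, T b = Sum.inr a → T (b.1, b.2 + 1) = Sum.inr c → a < c) ∧
  (∀ b : Box, b ∉ D → T b = Sum.inl 0)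

/-- The supersymmetric skew Schur function `s_D(X, Y)`, as a formal power series in the
variables `x_n, y_n`: the coefficient of a monomial `μ` is the number of super tableaux
of shape `D` using each symbol `v` exactly `μ v` times. -/
def superSchur (D : Set Box) : MvPowerSeries (ℕ ⊕ ℕ) ℤ :=
  fun μ =>
    ({T : Box → ℕ ⊕ ℕ | IsSuperSSYT D T ∧
        ∀ v : ℕ ⊕ ℕ, μ v = {b ∈ D | T b = v}.ncard}.ncard : ℤ)

theorem finite_ordConnected_of_isSkewShape {D : Set Box} (h : IsSkewShape D) :
    D.Finite ∧ D.OrdConnected := by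
  obtain ⟨lam, mu, -, rfl⟩ := h
  constructor
  · obtain ⟨N, hN⟩ := lam.eventually_zero
    refine (Set.finite_Icc ((1, 0) : Box) ((N : ℤ), (lam.part 0 : ℤ))).subset ?_
    rintro ⟨i, j⟩ ⟨h1, h2, h3⟩
    simp only at h1 h2 h3
    have h4 := lam.antitone (Nat.zero_le i.toNat)
    have h5 : ¬ N ≤ i.toNat := fun h => by
      have := hN _ h
      omega
    simp only [Set.mem_Icc, Prod.mk_le_mk]
    omega
  · refine ⟨?_⟩
    rintro ⟨i, j⟩ ⟨h1, h2, h3⟩ ⟨i', j'⟩ ⟨h1', h2', h3'⟩ ⟨a, b⟩ ⟨⟨h4, h5⟩, ⟨h6, h7⟩⟩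
    simp only at *
    have h8 := mu.antitone (show i.toNat ≤ a.toNat by omega)
    have h9 := lam.antitone (show a.toNat ≤ i'.toNat by omega)
    refine ⟨?_, ?_, ?_⟩ <;> simp only <;> omega

theorem ordConnected_of_isSkewLike {B : Set Box} (h : IsSkewLike B) : B.OrdConnected := by
  obtain ⟨v, hv⟩ := h
  have h1 := (finite_ordConnected_of_isSkewShape hv).2
  refine ⟨fun x hx y hy z hz => ?_⟩
  have := h1.out (Set.mem_image_of_mem (fun b => b + v) hx)
    (Set.mem_image_of_mem (fun b => b + v) hy)
    (show z + v ∈ _ from ⟨by simpa using hz.1, by simpa using hz.2⟩)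
  obtain ⟨w, hw, hwz⟩ := this
  rwa [← add_right_cancel hwz]

/-- The partition whose parts are the row lengths of a Young diagram. -/
def youngPartition (Y : YoungDiagram) : Partition' where
  part i := Y.rowLen (i - 1)
  antitone _ _ h := Y.rowLen_anti _ _ (Nat.sub_le_sub_right h 1)
  eventually_zero := ⟨Y.colLen 0 + 1, fun i hi => by
    by_contra h
    have h1 := YoungDiagram.mem_iff_lt_rowLen.2 (Nat.pos_of_ne_zero h)
    have h2 := YoungDiagram.mem_iff_lt_colLen.1 h1
    omega⟩

theorem mem_skewCells_youngPartition {Y Z : YoungDiagram} {b : Box} :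
    b ∈ skewCells (youngPartition Y) (youngPartition Z) ↔
      ∃ p q : ℕ, b = ((p : ℤ) + 1, (q : ℤ) + 1) ∧ (p, q) ∈ Y ∧ (p, q) ∉ Z := by
  obtain ⟨i, j⟩ := b
  simp only [YoungDiagram.mem_iff_lt_rowLen, skewCells, youngPartition, Set.mem_ofPred_eq,
    Prod.mk.injEq]
  constructor
  · rintro ⟨h1, h2, h3⟩
    rw [show i.toNat - 1 = (i - 1).toNat by omega] at h2 h3
    exact ⟨(i - 1).toNat, (j - 1).toNat, by omega, by omega, by omega⟩
  · rintro ⟨p, q, ⟨rfl, rfl⟩, h1, h2⟩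
    rw [show ((p : ℤ) + 1).toNat - 1 = p by omega]
    omega

theorem isSkewShape_of_ordConnected {B : Set Box} {M : ℕ}
    (hM : B ⊆ Set.Icc (1, 1) ((M : ℤ), (M : ℤ))) (hB : B.OrdConnected) : IsSkewShape B := by
  classical
  let Y : YoungDiagram :=
    { cells := (Finset.range M ×ˢ Finset.range M).filter
        fun p => ∃ b ∈ B, ((p.1 : ℤ) + 1, (p.2 : ℤ) + 1) ≤ b
      isLowerSet := by
        rintro ⟨p, q⟩ ⟨p', q'⟩ ⟨h1, h2⟩ h
        simp only [Finset.coe_filter, Finset.mem_product, Finset.mem_range,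
          Set.mem_ofPred_eq] at h h1 h2 ⊢
        obtain ⟨h3, b, hb, h4, h5⟩ := h
        refine ⟨by omega, b, hb, ?_, ?_⟩ <;> simp only at * <;> omega }
  let Z : YoungDiagram :=
    { cells := Y.cells.filter fun p => ¬ ∃ b ∈ B, b ≤ ((p.1 : ℤ) + 1, (p.2 : ℤ) + 1)
      isLowerSet := by
        rintro ⟨p, q⟩ ⟨p', q'⟩ ⟨h1, h2⟩ h
        rw [Finset.coe_filter, Set.mem_ofPred_eq] at h ⊢
        refine ⟨Y.isLowerSet ⟨h1, h2⟩ h.1, fun ⟨b, hb, h3, h4⟩ => h.2 ⟨b, hb, ?_, ?_⟩⟩ <;>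
          simp only at * <;> omega }
  have hZY : Z.cells ⊆ Y.cells := Finset.filter_subset _ _
  refine ⟨youngPartition Y, youngPartition Z, fun i => ?_, ?_⟩
  · by_contra! h
    exact lt_irrefl _ (YoungDiagram.mem_iff_lt_rowLen.1
      (hZY (YoungDiagram.mem_iff_lt_rowLen.2 h)))
  · have hY : ∀ p q : ℕ, (p, q) ∈ Y ↔
        (p < M ∧ q < M) ∧ ∃ b ∈ B, ((p : ℤ) + 1, (q : ℤ) + 1) ≤ b := fun p q => by
      rw [← YoungDiagram.mem_cells]
      simp [Y]
    have hZ : ∀ p q : ℕ, (p, q) ∈ Z ↔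
        (p, q) ∈ Y ∧ ¬ ∃ b ∈ B, b ≤ ((p : ℤ) + 1, (q : ℤ) + 1) := fun p q => by
      rw [← YoungDiagram.mem_cells, ← YoungDiagram.mem_cells]
      simp only [Z, Finset.mem_filter]
    ext b
    rw [mem_skewCells_youngPartition]
    constructor
    · intro hb
      obtain ⟨⟨h1, h2⟩, h3, h4⟩ := hM hb
      simp only at h1 h2 h3 h4
      have h5 : b = (((b.1 - 1).toNat : ℤ) + 1, ((b.2 - 1).toNat : ℤ) + 1) :=
        Prod.ext (by simp only; omega) (by simp only; omega)
      refine ⟨_, _, h5, (hY _ _).2 ⟨by omega, b, hb, h5.ge⟩, fun h => ?_⟩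
      exact ((hZ _ _).1 h).2 ⟨b, hb, h5.le⟩
    · rintro ⟨p, q, rfl, h1, h2⟩
      obtain ⟨-, b, hb, h3⟩ := (hY p q).1 h1
      rw [hZ, not_and, not_not] at h2
      obtain ⟨a, ha, h4⟩ := h2 h1
      exact hB.out ha hb ⟨h4, h3⟩

theorem isSkewLike_of_ordConnected {B : Set Box} (hf : B.Finite) (hB : B.OrdConnected) :
    IsSkewLike B := by
  obtain ⟨l, hl⟩ := hf.bddBelow
  obtain ⟨u, hu⟩ := hf.bddAbove
  refine ⟨(1, 1) - l, isSkewShape_of_ordConnected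
    (M := (u.1 - l.1 + 1).toNat + (u.2 - l.2 + 1).toNat) ?_ ⟨?_⟩⟩
  · rintro _ ⟨b, hb, rfl⟩
    obtain ⟨h1, h2⟩ := hl hb
    obtain ⟨h3, h4⟩ := hu hb
    refine ⟨⟨?_, ?_⟩, ⟨?_, ?_⟩⟩ <;>
      simp only [Prod.fst_add, Prod.snd_add, Prod.fst_sub, Prod.snd_sub] <;> omega
  · rintro _ ⟨a, ha, rfl⟩ _ ⟨b, hb, rfl⟩ z ⟨h1, h2⟩
    exact ⟨z - ((1, 1) - l), hB.out ha hb ⟨le_sub_iff_add_le.2 h1, sub_le_iff_le_add.2 h2⟩,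
      sub_add_cancel _ _⟩

/-- The box of content `c` on the diagonal translate through `b` of the path whose box of
content `c` lies in row `r c`. -/
def trackBox (r : ℤ → ℤ) (b : Box) (c : ℤ) : Box :=
  (b.1 - r (boxContent b) + r c, b.1 - r (boxContent b) + r c + c)

/-- The maximal connected segment through `b` of the part inside `D` of the translate through
`b` of the path described by `r`. -/
def trackStrip (D : Set Box) (r : ℤ → ℤ) (b : Box) : Set Box :=
  {x | x = trackBox r b (boxContent x) ∧
    ∀ c ∈ Set.uIcc (boxContent b) (boxContent x), trackBox r b c ∈ D}

/-- The path described by `r` goes up or right at each step. -/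
def IsTrack (r : ℤ → ℤ) : Prop := ∀ c, r (c + 1) = r c ∨ r (c + 1) = r c - 1

/-- The decomposition of `D` cut out by the diagonal translates of the path described by `r`. -/
def trackDecomposition (D : Set Box) (r : ℤ → ℤ) : Set (Set Box) := trackStrip D r '' D

@[simp]
theorem boxContent_trackBox (r : ℤ → ℤ) (b : Box) (c : ℤ) :
    boxContent (trackBox r b c) = c := by
  simp [boxContent, trackBox]

@[simp]
theorem trackBox_boxContent (r : ℤ → ℤ) (b : Box) : trackBox r b (boxContent b) = b := by
  simp [boxContent, trackBox]

@[simp]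
theorem trackBox_trackBox (r : ℤ → ℤ) (b : Box) (c : ℤ) :
    trackBox r (trackBox r b c) = trackBox r b := by
  funext c'
  simp [boxContent, trackBox]

section Track

variable {D : Set Box} {r : ℤ → ℤ} {b x y : Box}

theorem trackBox_eq_of_mem (h : x ∈ trackStrip D r b) : trackBox r x = trackBox r b := by
  rw [h.1, trackBox_trackBox]

theorem mem_trackStrip_self (hb : b ∈ D) : b ∈ trackStrip D r b :=
  ⟨by simp, by simpa using hb⟩

theorem trackStrip_subset : trackStrip D r b ⊆ D := fun x hx => by
  rw [hx.1]
  exact hx.2 _ Set.right_mem_uIcc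

theorem mem_trackStrip_symm (h : x ∈ trackStrip D r b) : b ∈ trackStrip D r x := by
  rw [trackStrip, Set.mem_ofPred_eq, trackBox_eq_of_mem h, Set.uIcc_comm]
  exact ⟨by simp, h.2⟩

theorem mem_trackStrip_trans (h : x ∈ trackStrip D r b) (h' : y ∈ trackStrip D r x) :
    y ∈ trackStrip D r b := by
  rw [trackStrip, Set.mem_ofPred_eq, trackBox_eq_of_mem h] at h'
  refine ⟨h'.1, fun c hc => ?_⟩
  rcases Set.uIcc_subset_uIcc_union_uIcc (b := boxContent x) hc with hc | hc
  · exact h.2 c hc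
  · exact h'.2 c hc

theorem trackStrip_eq_of_mem (h : x ∈ trackStrip D r b) : trackStrip D r x = trackStrip D r b :=
  Set.Subset.antisymm (fun _ => mem_trackStrip_trans h)
    fun _ => mem_trackStrip_trans (mem_trackStrip_symm h)

theorem trackBox_mem_trackStrip_add_one (hx : x ∈ D)
    (h : trackBox r x (boxContent x + 1) ∈ D) :
    trackBox r x (boxContent x + 1) ∈ trackStrip D r x := by
  refine ⟨by simp, fun c hc => ?_⟩
  rw [boxContent_trackBox, Set.uIcc_of_le (by omega)] at hc
  obtain rfl | rfl : c = boxContent x ∨ c = boxContent x + 1 := by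
    have := hc.1
    have := hc.2
    omega
  · simpa
  · exact h

theorem trackBox_mem_trackStrip_sub_one (hx : x ∈ D)
    (h : trackBox r x (boxContent x - 1) ∈ D) :
    trackBox r x (boxContent x - 1) ∈ trackStrip D r x := by
  refine ⟨by simp, fun c hc => ?_⟩
  rw [boxContent_trackBox, Set.uIcc_of_ge (by omega)] at hc
  obtain rfl | rfl : c = boxContent x ∨ c = boxContent x - 1 := by
    have := hc.1
    have := hc.2
    omega
  · simpa
  · exact h

theorem IsTrack.antitone (hr : IsTrack r) : Antitone r :=
  antitone_int_of_succ_le fun c => by rcases hr c with h | h <;> omega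

theorem IsTrack.monotone (hr : IsTrack r) : Monotone fun c => r c + c :=
  monotone_int_of_le_succ fun c => by rcases hr c with h | h <;> omega

theorem ordConnected_trackStrip (hr : IsTrack r) : (trackStrip D r b).OrdConnected := by
  refine ⟨fun x hx y hy z ⟨hxz, hzy⟩ => ?_⟩
  have hx1 := congrArg Prod.fst hx.1
  have hy1 := congrArg Prod.fst hy.1
  have key : z = trackBox r b (boxContent z) ∧
      boxContent z ∈ Set.uIcc (boxContent x) (boxContent y) := by
    obtain ⟨h1, h2⟩ := hxz
    obtain ⟨h3, h4⟩ := hzy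
    have e : ∀ w : Box, w.2 = w.1 + boxContent w := fun w => by simp [boxContent]
    have ex := e x
    have ey := e y
    have ez := e z
    simp only [trackBox] at hx1 hy1
    have hz : z.1 = b.1 - r (boxContent b) + r (boxContent z) ∧
        boxContent z ∈ Set.uIcc (boxContent x) (boxContent y) := by
      rcases le_total (boxContent x) (boxContent y) with h | h
      · rw [Set.uIcc_of_le h, Set.mem_Icc]
        have a1 := hr.antitone h
        have a2 : boxContent x ≤ boxContent z := by omega
        have a3 : boxContent z ≤ boxContent y := by omega
        have a4 := hr.antitone a2
        have a5 := hr.antitone a3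
        omega
      · rw [Set.uIcc_of_ge h, Set.mem_Icc]
        have a1 := hr.monotone h
        simp only at a1
        have a2 : boxContent z ≤ boxContent x := by omega
        have a3 : boxContent y ≤ boxContent z := by omega
        have a4 := hr.monotone a2
        have a5 := hr.monotone a3
        simp only at a4 a5
        omega
    refine ⟨Prod.ext hz.1 ?_, hz.2⟩
    simp only [trackBox]
    omega
  rw [← trackStrip_eq_of_mem hx] at hy ⊢
  rw [← trackBox_eq_of_mem hx] at key
  refine ⟨key.1, fun c hc => hy.2 c (Set.uIcc_subset_uIcc Set.left_mem_uIcc key.2 hc)⟩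

theorem boxAdj_trackBox_succ (hr : IsTrack r) (c : ℤ) :
    boxAdj (trackBox r b c) (trackBox r b (c + 1)) := by
  simp only [boxAdj, trackBox]
  rcases hr c with h | h <;> omega

theorem boxAdj_symm (h : boxAdj x y) : boxAdj y x := by
  simp only [boxAdj] at *
  omega

theorem edgewiseConnected_trackStrip (hr : IsTrack r) :
    EdgewiseConnected (trackStrip D r b) := by
  intro x hx y hy
  set R : Box → Box → Prop :=
    fun x y => x ∈ trackStrip D r b ∧ y ∈ trackStrip D r b ∧ boxAdj x y with hR
  have hsymm : Std.Symm R := ⟨fun u v ⟨h1, h2, h3⟩ => ⟨h2, h1, boxAdj_symm h3⟩⟩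
  have key : ∀ x ∈ trackStrip D r b, ∀ n, boxContent x ≤ n →
      (∀ c ∈ Set.Icc (boxContent x) n, trackBox r x c ∈ D) →
      Relation.ReflTransGen R x (trackBox r x n) := by
    intro x hx n hn
    have hin : ∀ m, boxContent x ≤ m → (∀ c ∈ Set.Icc (boxContent x) m, trackBox r x c ∈ D) →
        trackBox r x m ∈ trackStrip D r b := fun m hm h => by
      rw [← trackStrip_eq_of_mem hx]
      refine ⟨by simp, ?_⟩
      rwa [boxContent_trackBox, Set.uIcc_of_le hm]
    induction n, hn using Int.leInduction with
    | base =>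
      intro _
      rw [trackBox_boxContent]
    | succ n hn ih =>
      intro h
      have h' : ∀ c ∈ Set.Icc (boxContent x) n, trackBox r x c ∈ D :=
        fun c hc => h c ⟨hc.1, by have := hc.2; omega⟩
      exact (ih h').tail ⟨hin n hn h', hin (n + 1) (by omega) h, boxAdj_trackBox_succ hr n⟩
  rcases le_total (boxContent x) (boxContent y) with h | h
  · have h1 := hy
    rw [← trackStrip_eq_of_mem hx] at h1
    rw [h1.1]
    exact key x hx _ h (by rw [← Set.uIcc_of_le h]; exact h1.2)
  · have h1 := hx
    rw [← trackStrip_eq_of_mem hy] at h1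
    refine symm_of (Relation.ReflTransGen R) ?_
    rw [h1.1]
    exact key y hy _ h (by rw [← Set.uIcc_of_le h]; exact h1.2)

theorem isBorderStrip_trackStrip (hr : IsTrack r) (hD : D.Finite) (hb : b ∈ D) :
    IsBorderStrip (trackStrip D r b) := by
  refine ⟨⟨b, mem_trackStrip_self hb⟩,
    isSkewLike_of_ordConnected (hD.subset trackStrip_subset) (ordConnected_trackStrip hr),
    edgewiseConnected_trackStrip hr, ?_⟩
  rintro x ⟨h1, -, -, h4⟩
  have h5 : boxContent (x.1 + 1, x.2 + 1) = boxContent x := by simp [boxContent]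
  have h6 := h4.1
  rw [h5, ← h1.1] at h6
  have := congrArg Prod.fst h6
  simp at this

theorem trackBox_add_one (hr : IsTrack r) (x : Box) :
    trackBox r x (boxContent x + 1) =
      if r (boxContent x + 1) = r (boxContent x) then (x.1, x.2 + 1) else (x.1 - 1, x.2) := by
  have h := hr (boxContent x)
  have e : boxContent x = x.2 - x.1 := rfl
  split_ifs <;> simp only [trackBox, Prod.mk.injEq] <;> omega

theorem trackBox_sub_one (hr : IsTrack r) (x : Box) :
    trackBox r x (boxContent x - 1) =
      if r (boxContent x - 1) = r (boxContent x) then (x.1, x.2 - 1) else (x.1 + 1, x.2) := by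
  have h := hr (boxContent x - 1)
  have e : boxContent x = x.2 - x.1 := rfl
  rw [sub_add_cancel] at h
  split_ifs <;> simp only [trackBox, Prod.mk.injEq] <;> omega

theorem isOutsideDecomposition_trackDecomposition (hr : IsTrack r) (hD : D.Finite) :
    IsOutsideDecomposition D (trackDecomposition D r) := by
  refine ⟨?_, fun b hb => ?_, ?_, ?_⟩
  · rintro _ ⟨b, hb, rfl⟩
    exact ⟨isBorderStrip_trackStrip hr hD hb, trackStrip_subset⟩
  · refine ⟨trackStrip D r b, ⟨⟨b, hb, rfl⟩, mem_trackStrip_self hb⟩, ?_⟩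
    rintro _ ⟨⟨a, ha, rfl⟩, h⟩
    exact (trackStrip_eq_of_mem h).symm
  · rintro _ ⟨a, ha, rfl⟩ x ⟨h1, h2, h3⟩
    rw [← trackStrip_eq_of_mem h1] at h2 h3
    have h := trackBox_mem_trackStrip_sub_one (r := r) (trackStrip_subset h1)
    rw [trackBox_sub_one hr] at h
    split_ifs at h <;> tauto
  · rintro _ ⟨a, ha, rfl⟩ x ⟨h1, h2, h3⟩
    rw [← trackStrip_eq_of_mem h1] at h2 h3
    have h := trackBox_mem_trackStrip_add_one (r := r) (trackStrip_subset h1)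
    rw [trackBox_add_one hr] at h
    split_ifs at h <;> tauto

end Track

/-- The boxes `x` and `y` lie in the same member of `P`. -/
def SameStrip (P : Set (Set Box)) (x y : Box) : Prop := ∃ θ ∈ P, x ∈ θ ∧ y ∈ θ

theorem SameStrip.symm {P : Set (Set Box)} {x y : Box} (h : SameStrip P x y) :
    SameStrip P y x :=
  let ⟨θ, h1, h2, h3⟩ := h
  ⟨θ, h1, h3, h2⟩

theorem sameStrip_trackDecomposition {D : Set Box} {r : ℤ → ℤ} {x y : Box} (hx : x ∈ D)
    (hxy : boxContent y = boxContent x + 1) :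
    SameStrip (trackDecomposition D r) x y ↔
      y ∈ D ∧ y = trackBox r x (boxContent x + 1) := by
  constructor
  · rintro ⟨_, ⟨b, hb, rfl⟩, h1, h2⟩
    refine ⟨trackStrip_subset h2, ?_⟩
    rw [← hxy, trackBox_eq_of_mem h1]
    exact h2.1
  · rintro ⟨h1, h2⟩
    refine ⟨trackStrip D r x, ⟨x, hx, rfl⟩, mem_trackStrip_self hx, ?_⟩
    rw [h2] at h1 ⊢
    exact trackBox_mem_trackStrip_add_one hx h1

theorem sameStrip_trackDecomposition_right {D : Set Box} {r : ℤ → ℤ} (hr : IsTrack r)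
    {x : Box} (hx : x ∈ D) :
    SameStrip (trackDecomposition D r) x (x.1, x.2 + 1) ↔
      (x.1, x.2 + 1) ∈ D ∧ r (boxContent x + 1) = r (boxContent x) := by
  rw [sameStrip_trackDecomposition hx (by simp only [boxContent]; omega), trackBox_add_one hr]
  split_ifs with h <;> simp [h]

theorem sameStrip_trackDecomposition_up {D : Set Box} {r : ℤ → ℤ} (hr : IsTrack r)
    {x : Box} (hx : x ∈ D) :
    SameStrip (trackDecomposition D r) x (x.1 - 1, x.2) ↔
      (x.1 - 1, x.2) ∈ D ∧ r (boxContent x + 1) ≠ r (boxContent x) := by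
  rw [sameStrip_trackDecomposition hx (by simp only [boxContent]; omega), trackBox_add_one hr]
  split_ifs with h <;> simp [h]

theorem IsOutsideDecomposition.subset_of_sameStrip {D : Set Box} {P Q : Set (Set Box)}
    (hP : IsOutsideDecomposition D P) (hQ : IsOutsideDecomposition D Q)
    (h : ∀ x ∈ D, ∀ y ∈ D, boxAdj x y → SameStrip P x y → SameStrip Q x y)
    {θ η : Set Box} (hθ : θ ∈ P) (hη : η ∈ Q) {x : Box} (hx : x ∈ θ) (hx' : x ∈ η) :
    θ ⊆ η := by
  intro y hy
  have hc := (hP.1 θ hθ).1.2.2.1 x hx y hy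
  induction hc with
  | refl => exact hx'
  | @tail u v _ huv ih =>
    have huη := ih huv.1
    have huD := (hP.1 θ hθ).2 huv.1
    obtain ⟨ζ, hζ, h1, h2⟩ := h u huD v ((hP.1 θ hθ).2 hy) huv.2.2 ⟨θ, hθ, huv.1, huv.2.1⟩
    rwa [(hQ.2.1 u huD).unique ⟨hη, huη⟩ ⟨hζ, h1⟩]

theorem IsOutsideDecomposition.subset_of_sameStrip_iff {D : Set Box} {P Q : Set (Set Box)}
    (hP : IsOutsideDecomposition D P) (hQ : IsOutsideDecomposition D Q)
    (h : ∀ x ∈ D, ∀ y ∈ D, boxAdj x y → (SameStrip P x y ↔ SameStrip Q x y)) : P ⊆ Q := by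
  intro θ hθ
  obtain ⟨x, hx⟩ := (hP.1 θ hθ).1.1
  obtain ⟨η, ⟨hη, hx'⟩, -⟩ := hQ.2.1 x ((hP.1 θ hθ).2 hx)
  rwa [(hP.subset_of_sameStrip hQ (fun x hx y hy a => (h x hx y hy a).1) hθ hη hx hx').antisymm
    (hQ.subset_of_sameStrip hP (fun x hx y hy a => (h x hx y hy a).2) hη hθ hx' hx)]

/-- An outside decomposition is determined by which horizontally or vertically adjacent boxes
lie in the same strip. -/
theorem IsOutsideDecomposition.eq_of_sameStrip_iff {D : Set Box} {P Q : Set (Set Box)}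
    (hP : IsOutsideDecomposition D P) (hQ : IsOutsideDecomposition D Q)
    (hright : ∀ x ∈ D, (x.1, x.2 + 1) ∈ D →
      (SameStrip P x (x.1, x.2 + 1) ↔ SameStrip Q x (x.1, x.2 + 1)))
    (hup : ∀ x ∈ D, (x.1 - 1, x.2) ∈ D →
      (SameStrip P x (x.1 - 1, x.2) ↔ SameStrip Q x (x.1 - 1, x.2))) : P = Q := by
  have h : ∀ x ∈ D, ∀ y ∈ D, boxAdj x y → (SameStrip P x y ↔ SameStrip Q x y) := by
    have comm : ∀ P x y, SameStrip P x y ↔ SameStrip P y x :=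
      fun _ _ _ => ⟨SameStrip.symm, SameStrip.symm⟩
    rintro ⟨i, j⟩ hx ⟨i', j'⟩ hy h
    simp only [boxAdj] at h
    rcases h with ⟨rfl, rfl | rfl⟩ | ⟨rfl, rfl | rfl⟩
    · rw [comm P, comm Q]
      exact hright _ hy hx
    · exact hright _ hx hy
    · simpa using hup (i' + 1, j) hx (by simpa using hy)
    · rw [comm P, comm Q]
      simpa using hup (i + 1, j) hy (by simpa using hx)
  exact (hP.subset_of_sameStrip_iff hQ h).antisymm
    (hQ.subset_of_sameStrip_iff hP fun x hx y hy a => (h x hx y hy a).symm)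

section Diagonal

variable {D : Set Box} {P : Set (Set Box)} {x : Box}

theorem SameStrip.exists_both (hP : IsOutsideDecomposition D P) {y z : Box}
    (h1 : SameStrip P x y) (h2 : SameStrip P x z) : ∃ θ ∈ P, x ∈ θ ∧ y ∈ θ ∧ z ∈ θ := by
  obtain ⟨θ, hθ, hx, hy⟩ := h1
  obtain ⟨η, hη, hx', hz⟩ := h2
  obtain rfl := (hP.2.1 x ((hP.1 θ hθ).2 hx)).unique ⟨hθ, hx⟩ ⟨hη, hx'⟩
  exact ⟨θ, hθ, hx, hy, hz⟩

theorem not_sameStrip_up_and_right (hP : IsOutsideDecomposition D P)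
    (h1 : SameStrip P x (x.1 - 1, x.2)) (h2 : SameStrip P x (x.1, x.2 + 1)) : False := by
  obtain ⟨θ, hθ, hx, hy, hz⟩ := h1.exists_both hP h2
  obtain ⟨-, hs, -, hn⟩ := (hP.1 θ hθ).1
  have hc := (ordConnected_of_isSkewLike hs).out hy hz
    (show (x.1 - 1, x.2 + 1) ∈ _ by simp [Prod.le_def])
  exact hn (x.1 - 1, x.2) ⟨hy, hc, by simpa using hx, by simpa using hz⟩

theorem not_sameStrip_left_and_down (hP : IsOutsideDecomposition D P)
    (h1 : SameStrip P x (x.1, x.2 - 1)) (h2 : SameStrip P x (x.1 + 1, x.2)) : False := by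
  obtain ⟨θ, hθ, hx, hy, hz⟩ := h1.exists_both hP h2
  obtain ⟨-, hs, -, hn⟩ := (hP.1 θ hθ).1
  have hc := (ordConnected_of_isSkewLike hs).out hy hz
    (show (x.1 + 1, x.2 - 1) ∈ _ by simp [Prod.le_def])
  exact hn (x.1, x.2 - 1) ⟨hy, by simpa using hx, hc, by simpa using hz⟩

theorem sameStrip_up_or_right (hP : IsOutsideDecomposition D P) (hx : x ∈ D)
    (h1 : (x.1 - 1, x.2) ∈ D) (h2 : (x.1, x.2 + 1) ∈ D) :
    SameStrip P x (x.1 - 1, x.2) ∨ SameStrip P x (x.1, x.2 + 1) := by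
  obtain ⟨θ, ⟨hθ, hx'⟩, -⟩ := hP.2.1 x hx
  by_contra! h
  have := hP.2.2.2 θ hθ x ⟨hx', fun h' => h.1 ⟨θ, hθ, hx', h'⟩, fun h' => h.2 ⟨θ, hθ, hx', h'⟩⟩
  tauto

theorem sameStrip_left_or_down (hP : IsOutsideDecomposition D P) (hx : x ∈ D)
    (h1 : (x.1, x.2 - 1) ∈ D) (h2 : (x.1 + 1, x.2) ∈ D) :
    SameStrip P x (x.1, x.2 - 1) ∨ SameStrip P x (x.1 + 1, x.2) := by
  obtain ⟨θ, ⟨hθ, hx'⟩, -⟩ := hP.2.1 x hx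
  by_contra! h
  have := hP.2.2.1 θ hθ x ⟨hx', fun h' => h.1 ⟨θ, hθ, hx', h'⟩, fun h' => h.2 ⟨θ, hθ, hx', h'⟩⟩
  tauto

/-- The box `x` is joined in `P` to the box above it, or there is no box of `D` above it and
`x` is not joined to the box on its right. -/
def LeavesUp (D : Set Box) (P : Set (Set Box)) (x : Box) : Prop :=
  SameStrip P x (x.1 - 1, x.2) ∨ (¬ SameStrip P x (x.1, x.2 + 1) ∧ (x.1 - 1, x.2) ∉ D)

theorem sameStrip_up_iff (hP : IsOutsideDecomposition D P) :
    SameStrip P x (x.1 - 1, x.2) ↔ (x.1 - 1, x.2) ∈ D ∧ LeavesUp D P x := by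
  refine ⟨fun h => ⟨?_, Or.inl h⟩, fun ⟨h1, h2⟩ => by unfold LeavesUp at h2; tauto⟩
  obtain ⟨θ, hθ, -, h'⟩ := h
  exact (hP.1 θ hθ).2 h'

theorem sameStrip_right_iff (hP : IsOutsideDecomposition D P) (hx : x ∈ D) :
    SameStrip P x (x.1, x.2 + 1) ↔ (x.1, x.2 + 1) ∈ D ∧ ¬ LeavesUp D P x := by
  have h1 := not_sameStrip_up_and_right (x := x) hP
  have h2 := sameStrip_up_or_right (x := x) hP hx
  have h3 : SameStrip P x (x.1, x.2 + 1) → (x.1, x.2 + 1) ∈ D := fun ⟨θ, hθ, _, h'⟩ =>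
    (hP.1 θ hθ).2 h'
  unfold LeavesUp
  tauto

theorem leavesUp_diagonal_step (hP : IsOutsideDecomposition D P) (hD : D.OrdConnected)
    (hx : x ∈ D) (hy : (x.1 + 1, x.2 + 1) ∈ D) :
    LeavesUp D P x ↔ LeavesUp D P (x.1 + 1, x.2 + 1) := by
  have hz : (x.1, x.2 + 1) ∈ D := hD.out hx hy (by simp [Prod.le_def])
  have h1 := sameStrip_right_iff hP hx
  have h2 := sameStrip_up_iff (x := (x.1 + 1, x.2 + 1)) hP
  have h3 := not_sameStrip_left_and_down (x := (x.1, x.2 + 1)) hP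
  have h4 := sameStrip_left_or_down (x := (x.1, x.2 + 1)) hP hz
  simp only [add_sub_cancel_right] at h2 h3 h4
  simp only [Prod.mk.eta] at h3 h4
  rw [and_iff_right hz] at h1 h2
  rw [← not_iff_not, ← h1, ← h2]
  exact ⟨fun h h' => h3 h.symm h'.symm,
    fun h => ((h4 hx hy).resolve_right fun h' => h h'.symm).symm⟩

theorem leavesUp_diagonal (hP : IsOutsideDecomposition D P) (hD : D.OrdConnected)
    (hx : x ∈ D) (k : ℕ) (hy : (x.1 + k, x.2 + k) ∈ D) :
    LeavesUp D P x ↔ LeavesUp D P (x.1 + k, x.2 + k) := by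
  induction k with
  | zero => simp
  | succ k ih =>
    have hz : (x.1 + (k : ℤ), x.2 + (k : ℤ)) ∈ D := hD.out hx hy (by simp [Prod.le_def])
    rw [ih hz]
    have := leavesUp_diagonal_step hP hD hz (by simpa [add_assoc] using hy)
    simpa [add_assoc] using this

theorem leavesUp_congr (hP : IsOutsideDecomposition D P) (hD : D.OrdConnected) {y : Box}
    (hx : x ∈ D) (hy : y ∈ D) (hxy : boxContent x = boxContent y) :
    LeavesUp D P x ↔ LeavesUp D P y := by
  wlog h : x.1 ≤ y.1 generalizing x y
  · exact (this hy hx hxy.symm (le_of_not_ge h)).symm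
  simp only [boxContent] at hxy
  have e : y = (x.1 + ((y.1 - x.1).toNat : ℤ), x.2 + ((y.1 - x.1).toNat : ℤ)) :=
    Prod.ext (by simp only; omega) (by simp only; omega)
  rw [e] at hy ⊢
  exact leavesUp_diagonal hP hD hx _ hy

end Diagonal

/-- The contents `c` such that some box of `D` of content `c` is adjacent to some box of `D`
of content `c + 1`. -/
def linkedContents (D : Set Box) : Set ℤ :=
  {c | ∃ x ∈ D, boxContent x = c ∧ ((x.1, x.2 + 1) ∈ D ∨ (x.1 - 1, x.2) ∈ D)}

theorem exists_link_of_reflTransGen {D : Set Box} {a b : Box} {c : ℤ}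
    (h : Relation.ReflTransGen (fun x y => x ∈ D ∧ y ∈ D ∧ boxAdj x y) a b)
    (ha : boxContent a ≤ c) (hb : c < boxContent b) : c ∈ linkedContents D := by
  induction h with
  | refl => omega
  | @tail u v _ huv ih =>
    by_cases hu : c < boxContent u
    · exact ih hu
    obtain ⟨h1, h2, h3⟩ := huv
    obtain ⟨i, j⟩ := u
    obtain ⟨i', j'⟩ := v
    simp only [boxContent, boxAdj] at *
    refine ⟨(i, j), h1, by simp only [boxContent]; omega, ?_⟩
    obtain ⟨rfl, rfl⟩ | ⟨rfl, rfl⟩ : (i' = i ∧ j' = j + 1) ∨ (i' = i - 1 ∧ j' = j) := by omega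
    · exact Or.inl h2
    · exact Or.inr h2

theorem ncard_linkedContents {D : Set Box} (hf : D.Finite) (hne : D.Nonempty)
    (hconn : EdgewiseConnected D) :
    (linkedContents D).ncard = (boxContent '' D).ncard - 1 := by
  obtain ⟨m, hm, hmax⟩ := Set.exists_max_image D boxContent hf hne
  rw [← Set.ncard_sdiff_singleton_of_mem (Set.mem_image_of_mem boxContent hm)]
  congr 1
  ext c
  constructor
  · rintro ⟨x, hx, rfl, h⟩
    refine ⟨⟨x, hx, rfl⟩, fun hcm => ?_⟩
    rw [Set.mem_singleton_iff] at hcm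
    rcases h with h | h <;>
    · have := hmax _ h
      simp only [boxContent] at *
      omega
  · rintro ⟨⟨x, hx, rfl⟩, hcm⟩
    exact exists_link_of_reflTransGen (hconn x hx m hm) le_rfl (lt_of_le_of_ne (hmax x hx) hcm)

/-- The rows of a path that goes up exactly at the contents in `U`. -/
def upRow (U : Set ℤ) (c : ℤ) : ℤ := ((U ∩ Set.Ici c).ncard : ℤ)

theorem upRow_eq {U : Set ℤ} (hU : U.Finite) (c : ℤ) [Decidable (c ∈ U)] :
    upRow U c = upRow U (c + 1) + if c ∈ U then 1 else 0 := by
  have h : Set.Ici c = insert c (Set.Ici (c + 1)) := by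
    ext k
    simp only [Set.mem_Ici, Set.mem_insert_iff]
    omega
  unfold upRow
  rw [h]
  split_ifs with hc
  · rw [Set.inter_insert_of_mem hc, Set.ncard_insert_of_notMem (by simp) (hU.inter_of_left _)]
    push_cast
    rfl
  · rw [Set.inter_insert_of_notMem hc, add_zero]

theorem isTrack_upRow {U : Set ℤ} (hU : U.Finite) : IsTrack (upRow U) := fun c => by
  classical
  have := upRow_eq hU c
  split_ifs at this <;> omega

theorem upRow_succ_eq_iff {U : Set ℤ} (hU : U.Finite) (c : ℤ) :
    upRow U (c + 1) = upRow U c ↔ c ∉ U := by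
  classical
  have := upRow_eq hU c
  split_ifs at this <;> grind

theorem injOn_trackDecomposition_upRow {D : Set Box} (hA : (linkedContents D).Finite) :
    Set.InjOn (fun U => trackDecomposition D (upRow U)) (𝒫 linkedContents D) := by
  intro U hU V hV h
  simp only at h
  have hUf := hA.subset hU
  have hVf := hA.subset hV
  have key : ∀ c ∈ linkedContents D, c ∉ U ↔ c ∉ V := by
    rintro c ⟨x, hx, rfl, hl⟩
    rw [← upRow_succ_eq_iff hUf, ← upRow_succ_eq_iff hVf]
    rcases hl with hl | hl
    · have h1 := sameStrip_trackDecomposition_right (isTrack_upRow hUf) hx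
      have h2 := sameStrip_trackDecomposition_right (isTrack_upRow hVf) hx
      rw [h] at h1
      tauto
    · have h1 := sameStrip_trackDecomposition_up (isTrack_upRow hUf) hx
      have h2 := sameStrip_trackDecomposition_up (isTrack_upRow hVf) hx
      rw [h] at h1
      tauto
  ext c
  exact ⟨fun hc => by_contra fun hc' => (key c (hU hc)).2 hc' hc,
    fun hc => by_contra fun hc' => (key c (hV hc)).1 hc' hc⟩

theorem IsOutsideDecomposition.exists_eq_trackDecomposition {D : Set Box} {P : Set (Set Box)}
    (hP : IsOutsideDecomposition D P) (hf : D.Finite) (hD : D.OrdConnected)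
    (hA : (linkedContents D).Finite) :
    ∃ U ⊆ linkedContents D, trackDecomposition D (upRow U) = P := by
  set U : Set ℤ := {c ∈ linkedContents D | ∃ x ∈ D, boxContent x = c ∧ LeavesUp D P x} with hU
  have hUA : U ⊆ linkedContents D := Set.sep_subset _ _
  have hUf := hA.subset hUA
  have hr := isTrack_upRow hUf
  have key : ∀ x ∈ D, boxContent x ∈ linkedContents D →
      (boxContent x ∈ U ↔ LeavesUp D P x) := fun x hx hl =>
    ⟨fun ⟨_, y, hy, hxy, h⟩ => (leavesUp_congr hP hD hy hx hxy).1 h,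
      fun h => ⟨hl, x, hx, rfl, h⟩⟩
  refine ⟨U, hUA, (isOutsideDecomposition_trackDecomposition hr hf).eq_of_sameStrip_iff hP
    (fun x hx h => ?_) (fun x hx h => ?_)⟩
  · rw [sameStrip_trackDecomposition_right hr hx, sameStrip_right_iff hP hx,
      upRow_succ_eq_iff hUf, key x hx ⟨x, hx, rfl, Or.inl h⟩]
  · rw [sameStrip_trackDecomposition_up hr hx, sameStrip_up_iff hP, ne_eq,
      upRow_succ_eq_iff hUf, not_not, key x hx ⟨x, hx, rfl, Or.inr h⟩]

/-- An edgewise connected skew diagram with `d` diagonals has exactly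
`2 ^ (d - 1)` outside decompositions. -/
theorem card_outsideDecompositions
    (D : Set Box) (hD : IsSkewShape D) (hne : D.Nonempty) (hconn : EdgewiseConnected D)
    (d : ℕ) (hd : (boxContent '' D).ncard = d) :
    {P : Set (Set Box) | IsOutsideDecomposition D P}.ncard = 2 ^ (d - 1) := by
  obtain ⟨hf, hoc⟩ := finite_ordConnected_of_isSkewShape hD
  have hA : (linkedContents D).Finite := (hf.image boxContent).subset
    fun c ⟨x, hx, hc, _⟩ => ⟨x, hx, hc⟩
  have himg : {P : Set (Set Box) | IsOutsideDecomposition D P} =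
      (fun U => trackDecomposition D (upRow U)) '' 𝒫 linkedContents D := by
    ext P
    constructor
    · exact fun hP => hP.exists_eq_trackDecomposition hf hoc hA
    · rintro ⟨U, hU, rfl⟩
      exact isOutsideDecomposition_trackDecomposition (isTrack_upRow (hA.subset hU)) hf
  rw [himg, (injOn_trackDecomposition_upRow hA).ncard_image,
    Set.ncard_powerset _ hA, ncard_linkedContents hf hne hconn, hd]
end
end

section
/- Let λ/μ be an edgewise connected skew diagram and let Π = (θ_1, …, θ_m) be an outside decomposition of λ/μ, indexed so that q(θ_1) > q(θ_2) > ⋯ > q(θ_m), and let p_1 > p_2 > ⋯ > p_m be the decreasing rearrangement of p(θ_1), …, p(θ_m). Then s_{λ/μ} = (−1)^{inv(Π)} · det(M), where M is the m×m matrix whose (i,j) entry is the ribbon Schur function s_{φ[p_j, q(θ_i)]} when p_j ≤ q(θ_i) + 1 (with the convention s_{φ[q+1,q]} = s_∅ = 1), and is 0 when p_j > q(θ_i) + 1. -/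
noncomputable section

open Finset in
/-- The Cauchy–Binet formula, where `G` is a set of representatives, up to permutation of the
columns, of the column selections that contribute. -/
theorem det_mul_eq_sum_of_representatives {ι S R : Type*} [Fintype ι] [DecidableEq ι] [Fintype S]
    [DecidableEq S] [CommRing R] (A : Matrix ι S R) (B : Matrix S ι R) (G : Finset (ι → S))
    (hinj : ∀ g ∈ G, Function.Injective g)
    (huniq : ∀ g ∈ G, ∀ g' ∈ G, ∀ π : Equiv.Perm ι, g ∘ π = g' → g = g')
    (hcover : ∀ g : ι → S, Function.Injective g → (A.submatrix id g).det ≠ 0 →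
      (∀ i, B (g i) i ≠ 0) → ∃ g₀ ∈ G, ∃ π : Equiv.Perm ι, g = g₀ ∘ π) :
    (A * B).det = ∑ g ∈ G, (A.submatrix id g).det * (B.submatrix g id).det := by
  have expand : (A * B).det = ∑ g : ι → S, (A.submatrix id g).det * ∏ i, B (g i) i := by
    rw [← Matrix.det_transpose]
    have h1 : (A * B).transpose = fun i => ∑ z, B z i • A.transpose z := by
      ext i j
      simp [Matrix.mul_apply, mul_comm]
    rw [h1]
    change Matrix.detRowAlternating (fun i => ∑ z, B z i • A.transpose z) = _
    rw [← AlternatingMap.coe_multilinearMap, MultilinearMap.map_sum]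
    refine sum_congr rfl fun g _ => ?_
    rw [MultilinearMap.map_smul_univ, smul_eq_mul, mul_comm]
    congr 1
    change Matrix.det (fun i => A.transpose (g i)) = _
    rw [← Matrix.det_transpose]
    rfl
  have perm : ∀ g ∈ G, (A.submatrix id g).det * (B.submatrix g id).det =
      ∑ π : Equiv.Perm ι, (A.submatrix id (g ∘ π)).det * ∏ i, B ((g ∘ π) i) i := by
    intro g _
    rw [(B.submatrix g id).det_apply, mul_sum]
    refine sum_congr rfl fun π _ => ?_
    have : (A.submatrix id (g ∘ π)) = (A.submatrix id g).submatrix id π := rfl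
    rw [this, Matrix.det_permute', Units.smul_def, zsmul_eq_mul]
    simp only [Matrix.submatrix_apply, id, Function.comp_apply]
    ring
  rw [expand, sum_congr rfl perm, ← sum_product']
  symm
  refine sum_of_injOn (fun x => x.1 ∘ x.2) ?_ (fun _ _ => by simp) ?_ (fun _ _ => rfl)
  · rintro ⟨g, π⟩ hg ⟨g', π'⟩ hg' h
    simp only [coe_product, Set.mem_prod, mem_coe, and_true, coe_univ,
      Set.mem_univ] at hg hg' h
    have hgg : g = g' := huniq g hg g' hg' (π * π'⁻¹) (by
      funext i
      have := congrFun h (π'⁻¹ i)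
      simpa using this)
    subst hgg
    congr 1
    ext i
    exact hinj g hg (congrFun h i)
  · intro g _ hg
    by_contra hne
    have hA := left_ne_zero_of_mul hne
    have hB := right_ne_zero_of_mul hne
    have hgi : Function.Injective g := by
      intro i j hij
      by_contra hne'
      exact hA (Matrix.det_zero_of_column_eq hne' fun k => by simp [hij])
    obtain ⟨g₀, hg₀, π, rfl⟩ := hcover g hgi hA fun i h0 => hB (prod_eq_zero (mem_univ i) h0)
    exact hg ⟨(g₀, π), by simp [hg₀], rfl⟩

open Finset in
/-- The minor of a `0`-`1` step matrix with rows and columns sorted along a common order: it is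
`1` when the row and column values interlace and `0` otherwise. -/
theorem det_interlace {ι R : Type*} [Fintype ι] [DecidableEq ι] [CommRing R]
    (act : ι → Prop) [DecidablePred act] (ξ η o : ι → ℤ)
    (ho : ∀ i j, act i → act j → o i = o j → i = j)
    (hξ : ∀ i j, act i → act j → o i < o j → ξ i < ξ j)
    (hη : ∀ i j, act i → act j → o i < o j → η i < η j)
    (M : Matrix ι ι R)
    (hM : ∀ i j, act i → act j → M i j = if ξ i ≤ η j then 1 else 0)
    (hM' : ∀ i j, ¬ (act i ∧ act j) → M i j = if i = j then 1 else 0)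
    [Decidable ((∀ i, act i → ξ i ≤ η i) ∧ ∀ i j, act i → act j → o i < o j → η i < ξ j)] :
    M.det = if (∀ i, act i → ξ i ≤ η i) ∧ (∀ i j, act i → act j → o i < o j → η i < ξ j)
      then 1 else 0 := by
  have hξ' : ∀ i j, act i → act j → o i ≤ o j → ξ i ≤ ξ j := by
    intro i j hi hj h
    rcases h.lt_or_eq with h | h
    · exact (hξ i j hi hj h).le
    · rw [ho i j hi hj h]
  have hη' : ∀ i j, act i → act j → o i ≤ o j → η i ≤ η j := by
    intro i j hi hj h
    rcases h.lt_or_eq with h | h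
    · exact (hη i j hi hj h).le
    · rw [ho i j hi hj h]
  split_ifs with hgood
  · obtain ⟨h1, h2⟩ := hgood
    rw [Matrix.det_apply, sum_eq_single 1]
    · rw [Equiv.Perm.sign_one, one_smul]
      refine prod_eq_one fun i _ => ?_
      by_cases hi : act i
      · simp [hM i i hi hi, h1 i hi]
      · simp [hM' i i (by simp [hi])]
    · intro σ _ hσ
      by_contra hne
      have hne' : ∏ i, M (σ i) i ≠ 0 := fun h => hne (by rw [h, smul_zero])
      have hnz : ∀ i, M (σ i) i ≠ 0 := fun i h => hne' (prod_eq_zero (mem_univ i) h)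
      have hle : ∀ i, o (σ i) ≤ o i ∧ (o (σ i) = o i → σ i = i) := by
        intro i
        have h := hnz i
        by_cases ha : act (σ i) ∧ act i
        · rw [hM _ _ ha.1 ha.2] at h
          refine ⟨?_, ho _ _ ha.1 ha.2⟩
          by_contra hlt
          have := h2 i (σ i) ha.2 ha.1 (not_le.1 hlt)
          simp [not_le.2 this] at h
        · rw [hM' _ _ ha] at h
          have : σ i = i := by
            by_contra hc
            simp [hc] at h
          simp [this]
      have hsum : ∑ i, o (σ i) = ∑ i, o i := Equiv.sum_comp σ o
      have := (sum_eq_sum_iff_of_le fun i _ => (hle i).1).1 hsum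
      exact hσ (Equiv.ext fun i => (hle i).2 (this i (mem_univ i)))
    · simp
  · have hbad : (univ.filter fun j => act j ∧
        (η j < ξ j ∨ ∃ i, act i ∧ o i < o j ∧ ξ j ≤ η i)).Nonempty := by
      by_contra hemp
      rw [not_nonempty_iff_eq_empty, filter_eq_empty_iff] at hemp
      refine hgood ⟨fun i hi => ?_, fun i j hi hj hij => ?_⟩
      · by_contra hc
        exact hemp (mem_univ i) ⟨hi, Or.inl (not_le.1 hc)⟩
      · by_contra hc
        exact hemp (mem_univ j) ⟨hj, Or.inr ⟨i, hi, hij, not_lt.1 hc⟩⟩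
    obtain ⟨j, hj, hmin⟩ := exists_min_image _ o hbad
    simp only [mem_filter, mem_univ, true_and] at hj hmin
    obtain ⟨hja, hj⟩ := hj
    have hprev : ∀ k, act k → o k < o j → ξ k ≤ η k ∧ ∀ i, act i → o i < o k → η i < ξ k := by
      intro k hk hkj
      refine ⟨?_, fun i hi hik => ?_⟩
      · by_contra hc
        exact absurd (hmin k ⟨hk, Or.inl (not_le.1 hc)⟩) (not_le.2 hkj)
      · by_contra hc
        exact absurd (hmin k ⟨hk, Or.inr ⟨i, hi, hik, not_lt.1 hc⟩⟩) (not_le.2 hkj)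
    by_cases hB : ∃ i, act i ∧ o i < o j ∧ ξ j ≤ η i
    · obtain ⟨i, hi, hij, hle⟩ := hB
      have hne : i ≠ j := by rintro rfl; exact lt_irrefl _ hij
      refine Matrix.det_zero_of_row_eq hne (funext fun k => ?_)
      by_cases hk : act k
      · rw [hM i k hi hk, hM j k hja hk]
        have hlt := hξ i j hi hja hij
        rcases le_or_gt (o i) (o k) with h | h
        · have := hη' i k hi hk h
          rw [if_pos (by omega), if_pos (by omega)]
        · have := (hprev i hi hij).2 k hk h
          rw [if_neg (by omega), if_neg (by omega)]
      · rw [hM' i k (by simp [hk]), hM' j k (by simp [hk]), if_neg, if_neg]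
        · rintro rfl; exact hk hja
        · rintro rfl; exact hk hi
    · have hj : η j < ξ j := hj.resolve_right hB
      have hB' : ∀ i, act i → o i < o j → η i < ξ j := by
        intro i hi hij
        by_contra hc
        exact hB ⟨i, hi, hij, not_lt.1 hc⟩
      by_cases hpre : (univ.filter fun i => act i ∧ o i < o j).Nonempty
      · obtain ⟨i, hi, hmax⟩ := exists_max_image _ o hpre
        simp only [mem_filter, mem_univ, true_and] at hi hmax
        obtain ⟨hi, hij⟩ := hi
        have hne : i ≠ j := by rintro rfl; exact lt_irrefl _ hij
        refine Matrix.det_zero_of_column_eq hne fun k => ?_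
        by_cases hk : act k
        · rw [hM k i hk hi, hM k j hk hja]
          have hlt := hη i j hi hja hij
          rcases le_or_gt (o j) (o k) with h | h
          · have := hξ' j k hja hk h
            rw [if_neg (by omega), if_neg (by omega)]
          · have h1 := hξ' k i hk hi (hmax k ⟨hk, h⟩)
            have h2 := (hprev i hi hij).1
            rw [if_pos (by omega), if_pos (by omega)]
        · rw [hM' k i (by simp [hk]), hM' k j (by simp [hk]), if_neg, if_neg]
          · rintro rfl; exact hk hja
          · rintro rfl; exact hk hi
      · refine Matrix.det_eq_zero_of_column_eq_zero j fun k => ?_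
        by_cases hk : act k
        · rw [hM k j hk hja, if_neg]
          have : o j ≤ o k := by
            by_contra hc
            exact hpre ⟨k, by simp [hk, not_le.1 hc]⟩
          have := hξ' j k hja hk this
          omega
        · rw [hM' k j (by simp [hk]), if_neg]
          rintro rfl; exact hk hja

open Finset in
/-- Iterating a one-step recursion expands it as a sum over sequences of states. -/
theorem sum_sequences {Γ R : Type*} [Fintype Γ] [DecidableEq Γ] [CommRing R]
    (G : ℕ → Finset Γ) (k : ℕ → Γ → Γ → R) (K : ℕ → Γ → R)
    (h0 : ∀ g ∈ G 0, K 0 g = 1)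
    (hstep : ∀ l, ∀ g' ∈ G (l + 1), K (l + 1) g' = ∑ g ∈ G l, K l g * k l g g')
    (L : ℕ) (F : Γ → R) :
    ∑ g ∈ G L, K L g * F g =
      ∑ γ ∈ Fintype.piFinset (fun l : Fin (L + 1) => G l),
        (∏ l : Fin L, k l (γ l.castSucc) (γ l.succ)) * F (γ (Fin.last L)) := by
  induction L generalizing F with
  | zero =>
    refine sum_bij (fun g _ => fun _ => g) ?_ ?_ ?_ ?_
    · intro g hg
      simpa [Fintype.mem_piFinset] using hg
    · intro a _ b _ h
      exact congrFun h 0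
    · intro γ hγ
      rw [Fintype.mem_piFinset] at hγ
      exact ⟨γ 0, hγ 0, funext fun l => by rw [Fin.fin_one_eq_zero l]⟩
    · intro g hg
      simp [h0 g hg]
  | succ L ih =>
    have e1 : ∑ g' ∈ G (L + 1), K (L + 1) g' * F g' =
        ∑ g ∈ G L, K L g * ∑ g' ∈ G (L + 1), k L g g' * F g' := by
      rw [sum_congr rfl fun g' hg' => by rw [hstep L g' hg', sum_mul], sum_comm]
      refine sum_congr rfl fun g _ => ?_
      rw [mul_sum]
      exact sum_congr rfl fun g' _ => by ring
    rw [e1, ih]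
    simp_rw [mul_sum]
    rw [← sum_product']
    refine sum_bij (fun x _ => Fin.snoc x.1 x.2) ?_ ?_ ?_ ?_
    · rintro ⟨γ, g⟩ hx
      simp only [mem_product, Fintype.mem_piFinset] at hx ⊢
      intro l
      refine Fin.lastCases ?_ (fun l => ?_) l
      · simpa using hx.2
      · simpa using hx.1 l
    · rintro ⟨γ, g⟩ _ ⟨γ', g'⟩ _ h
      obtain ⟨h1, h2⟩ := Fin.snoc_inj.1 h
      exact Prod.ext h1 h2
    · intro γ hγ
      rw [Fintype.mem_piFinset] at hγ
      refine ⟨(Fin.init γ, γ (Fin.last _)), ?_, Fin.snoc_init_self γ⟩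
      simp only [mem_product, Fintype.mem_piFinset]
      exact ⟨fun l => hγ l.castSucc, hγ (Fin.last _)⟩
    · rintro ⟨γ, g⟩ _
      rw [Fin.prod_univ_castSucc]
      simp [← Fin.castSucc_succ, mul_assoc]

open Finset in
theorem exists_sorted_of_card_eq {ι : Type*} {N : ℕ} [NeZero N] (I : Finset ι) (key : ι → ℤ)
    (hkey : Set.InjOn key I) (V : Finset (Fin N)) (hcard : V.card = I.card) :
    ∃ x : ι → Fin N, (∀ i ∈ I, x i ∈ V) ∧ ∀ i ∈ I, ∀ j ∈ I, key i < key j → x i < x j := by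
  classical
  have hK : (I.image key).card = V.card := by rw [card_image_of_injOn hkey, hcard]
  let e := ((I.image key).orderIsoOfFin hK).symm
  refine ⟨fun i => if h : key i ∈ I.image key then V.orderEmbOfFin rfl (e ⟨key i, h⟩) else 0,
    fun i hi => ?_, fun i hi j hj hij => ?_⟩
  · simp only [mem_image_of_mem key hi, dite_true]
    exact orderEmbOfFin_mem _ _ _
  · simp only [mem_image_of_mem key hi, mem_image_of_mem key hj, dite_true]
    rw [OrderEmbedding.lt_iff_lt, OrderIso.lt_iff_lt]
    exact hij

open Finset in
theorem sorted_unique {ι α : Type*} [LinearOrder α] (I : Finset ι) (key : ι → ℤ)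
    (hkey : Set.InjOn key I) (x y : ι → α)
    (hx : ∀ i ∈ I, ∀ j ∈ I, key i < key j → x i < x j)
    (hy : ∀ i ∈ I, ∀ j ∈ I, key i < key j → y i < y j)
    (hxy : ∀ i ∈ I, ∃ j ∈ I, y j = x i) (hyx : ∀ i ∈ I, ∃ j ∈ I, x j = y i) :
    ∀ i ∈ I, x i = y i := by
  classical
  by_contra! hbad
  obtain ⟨i₀, hi₀, hne₀⟩ := hbad
  obtain ⟨i, hi, hmin⟩ := exists_min_image (I.filter fun i => x i ≠ y i) key
    ⟨i₀, by simp [hi₀, hne₀]⟩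
  simp only [mem_filter] at hi hmin
  obtain ⟨hi, hne⟩ := hi
  have main : ∀ x y : ι → α, (∀ i ∈ I, ∀ j ∈ I, key i < key j → x i < x j) →
      (∀ i ∈ I, ∀ j ∈ I, key i < key j → y i < y j) → (∀ i ∈ I, ∃ j ∈ I, y j = x i) →
      (∀ j ∈ I, key j < key i → x j = y j) → ¬ x i < y i := by
    intro x y hx hy hxy hpre hlt
    obtain ⟨j, hj, hji⟩ := hxy i hi
    rcases lt_trichotomy (key j) (key i) with h | h | h
    · have := hx j hj i hi h
      rw [hpre j hj h, hji] at this
      exact lt_irrefl _ this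
    · rw [hkey hj hi h] at hji
      exact hlt.ne hji.symm
    · have := hy i hi j hj h
      rw [hji] at this
      exact lt_asymm hlt this
  have hpre : ∀ j ∈ I, key j < key i → x j = y j := by
    intro j hj hlt
    by_contra hc
    exact absurd (hmin j ⟨hj, hc⟩) (not_le.2 hlt)
  rcases lt_or_gt_of_ne hne with h | h
  · exact main x y hx hy hxy hpre h
  · exact main y x hy hx hyx (fun j hj h => (hpre j hj h).symm) h

/-- States of a lattice path: a current value, waiting to start at level `p`, or finished at
level `q`. -/
inductive PathState (N L : ℕ)
  | val (x : Fin N)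
  | src (p : Fin L)
  | snk (q : Fin L)

namespace PathState

instance (N L : ℕ) : DecidableEq (PathState N L) := Classical.decEq _

/-- States as a sum type. -/
def toSum {N L : ℕ} : PathState N L → Fin N ⊕ Fin L ⊕ Fin L
  | val x => Sum.inl x
  | src p => Sum.inr (Sum.inl p)
  | snk q => Sum.inr (Sum.inr q)

theorem toSum_injective {N L : ℕ} : Function.Injective (toSum : PathState N L → _) := by
  intro z z' h
  cases z <;> cases z' <;> simp_all [toSum]

instance (N L : ℕ) : Fintype (PathState N L) := Fintype.ofInjective toSum toSum_injective

end PathState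

/-- A step from value `x` to value `y` is allowed when `rowKey u x ≤ colKey u y`: for a step
going right this means `x ≤ y`, for a step going up `y < x`. -/
def rowKey (u : Bool) (x : ℕ) : ℤ := if u then 1 - x else x

/-- The key of the value reached by a step; see `rowKey`. -/
def colKey (u : Bool) (y : ℕ) : ℤ := if u then -y else y

section Transfer

open PathState

variable {R : Type*} [CommRing R] {N L : ℕ} (up : ℕ → Bool) (X : ℕ → R)

/-- The weight of a state. -/
def stateWeight : PathState N L → R
  | val y => X y
  | _ => 1

/-- The unweighted one-step matrix from level `l` to level `l + 1`. -/
def stepMatrix (R : Type*) [CommRing R] (l : ℕ) : Matrix (PathState N L) (PathState N L) R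
  | val x, val y => if rowKey (up l) x ≤ colKey (up l) y then 1 else 0
  | val _, snk q => if (q : ℕ) = l then 1 else 0
  | val _, src _ => 0
  | src p, val _ => if (p : ℕ) = l + 1 then 1 else 0
  | src p, src p' => if p = p' ∧ l + 1 < p then 1 else 0
  | src p, snk q => if (p : ℕ) = l + 1 ∧ (q : ℕ) = l then 1 else 0
  | snk q, snk q' => if q = q' ∧ (q : ℕ) < l then 1 else 0
  | snk _, _ => 0

/-- The transfer matrix from level `l` to level `l + 1`. -/
def transfer (l : ℕ) : Matrix (PathState N L) (PathState N L) R :=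
  Matrix.of fun z z' => stateWeight X z' * stepMatrix up R l z z'

/-- The generating function of paths from level `0` to level `l`. -/
def pathGF : ℕ → Matrix (PathState N L) (PathState N L) R
  | 0 => 1
  | l + 1 => pathGF l * transfer up X l

theorem pathGF_succ_apply (l : ℕ) (z z' : PathState N L) :
    pathGF up X (l + 1) z z' = ∑ y, pathGF up X l z y * transfer up X l y z' := rfl

theorem pathGF_src_of_lt {l : ℕ} {p : Fin L} (h : l < p) (z : PathState N L) :
    pathGF up X l (src p) z = if z = src p then 1 else 0 := by
  induction l generalizing z with
  | zero => simp [pathGF, Matrix.one_apply, eq_comm]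
  | succ l ih =>
    rw [pathGF_succ_apply, Finset.sum_eq_single (src p)]
    · rw [ih (by omega), if_pos rfl, one_mul]
      rcases z with x | p' | q
      · simp [transfer, stepMatrix, h.ne']
      · simp [transfer, stepMatrix, h, stateWeight, eq_comm]
      · simp [transfer, stepMatrix, h.ne']
    · intro y _ hy
      rw [ih (by omega), if_neg hy, zero_mul]
    · simp

theorem pathGF_src_src_of_le {l : ℕ} {p p' : Fin L} (hp : 0 < (p' : ℕ)) (h : (p' : ℕ) ≤ l) :
    pathGF up X l (src p : PathState N L) (src p') = 0 := by
  obtain _ | l := l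
  · omega
  · rw [pathGF_succ_apply]
    refine Finset.sum_eq_zero fun y _ => ?_
    rcases y with x | p'' | q
    · simp [transfer, stepMatrix]
    · have : ¬ (p'' = p' ∧ l + 1 < (p'' : ℕ)) := by rintro ⟨rfl, h'⟩; omega
      simp [transfer, stepMatrix, this]
    · simp [transfer, stepMatrix]

theorem pathGF_src_src_of_ne {l : ℕ} {p p' : Fin L} (h : p ≠ p') :
    pathGF up X l (src p : PathState N L) (src p') = 0 := by
  induction l with
  | zero => simp [pathGF, h]
  | succ l ih =>
    rw [pathGF_succ_apply]
    refine Finset.sum_eq_zero fun y _ => ?_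
    rcases y with x | p'' | q
    · simp [transfer, stepMatrix]
    · by_cases hp : p'' = p'
      · subst hp
        rw [ih, zero_mul]
      · simp [transfer, stepMatrix, hp]
    · simp [transfer, stepMatrix]

theorem pathGF_snk_stable {l : ℕ} {q : Fin L} (h : (q : ℕ) < l) (z : PathState N L) (k : ℕ) :
    pathGF up X (l + k) z (snk q) = pathGF up X l z (snk q) := by
  induction k with
  | zero => rfl
  | succ k ih =>
    rw [← ih, ← add_assoc, pathGF_succ_apply, Finset.sum_eq_single (snk q)]
    · simp [transfer, stepMatrix, stateWeight, show (q : ℕ) < l + k by omega]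
    · intro y _ hy
      have h1 : (q : ℕ) ≠ l + k := by omega
      rcases y with x | p'' | q'
      · simp [transfer, stepMatrix, h1]
      · simp [transfer, stepMatrix, h1]
      · have : q' ≠ q := fun e => hy (by rw [e])
        simp [transfer, stepMatrix, this]
    · simp

/-- The generating function of paths from the source at level `p` to the sink at level `q`. -/
def ribbonGF (N : ℕ) (p q : Fin L) : R := pathGF up X L (src p : PathState N L) (snk q)

theorem ribbonGF_of_gt {p q : Fin L} (h : (q : ℕ) < p) :
    ribbonGF up X N p q = if (p : ℕ) = q + 1 then 1 else 0 := by
  obtain ⟨k, hk⟩ := Nat.exists_eq_add_of_lt q.2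
  have hL : L = (q + 1 : ℕ) + k := by omega
  have e : ribbonGF up X N p q = pathGF up X (q + 1) (src p : PathState N L) (snk q) := by
    rw [← pathGF_snk_stable up X (Nat.lt_succ_self (q : ℕ)) _ k]
    unfold ribbonGF
    congr 1
  rw [e, pathGF_succ_apply, Finset.sum_eq_single (src p)]
  · rw [pathGF_src_of_lt up X h, if_pos rfl]
    simp [transfer, stepMatrix, stateWeight]
  · intro y _ hy
    rw [pathGF_src_of_lt up X h, if_neg hy, zero_mul]
  · simp

end Transfer

/-- The box following `b`, upwards when `u` and to the right otherwise. -/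
def nextBox (u : Bool) (b : Box) : Box := if u then (b.1 - 1, b.2) else (b.1, b.2 + 1)

/-- The coordinate, constant in the direction `u`, that orders the boxes of a diagonal. -/
def orderKey (u : Bool) (b : Box) : ℤ := if u then -b.2 else b.1

/-- A decomposition of a finite convex set of boxes into strips, all of which go in the direction
`up l` on leaving level `l`; the `l`-th level consists of the boxes of content `off + l`. -/
structure StripDecomposition (ι : Type) (L : ℕ) (D : Finset Box) (up : ℕ → Bool) (off : ℤ) where
  p : ι → Fin L
  q : ι → Fin L
  box : ι → ℕ → Box
  p_pos : ∀ i, 0 < (p i : ℕ)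
  p_le_q : ∀ i, p i ≤ q i
  p_inj : Function.Injective p
  q_inj : Function.Injective q
  convex : ∀ a ∈ D, ∀ b ∈ D, ∀ e : Box, a.1 ≤ e.1 → e.1 ≤ b.1 → a.2 ≤ e.2 → e.2 ≤ b.2 → e ∈ D
  box_mem : ∀ i (l : ℕ), p i ≤ l → l ≤ q i → box i l ∈ D
  content_box : ∀ i (l : ℕ), p i ≤ l → l ≤ q i → boxContent (box i l) = off + l
  exists_box : ∀ b ∈ D, ∃ i, ∃ l : ℕ, p i ≤ l ∧ l ≤ q i ∧ box i l = b
  box_inj : ∀ i j (l : ℕ), p i ≤ l → l ≤ q i → p j ≤ l → l ≤ q j → box i l = box j l → i = j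
  box_succ : ∀ i (l : ℕ), p i ≤ l → l < q i → box i (l + 1) = nextBox (up l) (box i l)
  lt_q_of_next_mem : ∀ i (l : ℕ), p i ≤ l → l ≤ q i → nextBox (up l) (box i l) ∈ D → l < q i

namespace StripDecomposition

variable {ι : Type} {L : ℕ} {D : Finset Box} {up : ℕ → Bool} {off : ℤ}
  (S : StripDecomposition ι L D up off)

theorem exists_box_at (S : StripDecomposition ι L D up off) {b : Box} (hb : b ∈ D) {l : ℕ}
    (hl : boxContent b = off + l) :
    ∃ i, S.p i ≤ l ∧ l ≤ S.q i ∧ S.box i l = b := by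
  obtain ⟨i, l', h1, h2, rfl⟩ := S.exists_box b hb
  have := S.content_box i l' h1 h2
  obtain rfl : l' = l := by omega
  exact ⟨i, h1, h2, rfl⟩

theorem orderKey_inj (u : Bool) {i j : ι} {l : ℕ} (hi : S.p i ≤ l) (hi' : l ≤ S.q i)
    (hj : S.p j ≤ l) (hj' : l ≤ S.q j) (h : orderKey u (S.box i l) = orderKey u (S.box j l)) :
    i = j := by
  refine S.box_inj i j l hi hi' hj hj' ?_
  have h1 := S.content_box i l hi hi'
  have h2 := S.content_box j l hj hj'
  simp only [boxContent, orderKey] at h h1 h2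
  apply Prod.ext <;> split_ifs at h <;> omega

/-- A strip starting at level `l + 1` precedes the strips passing through level `l`. -/
theorem orderKey_start_lt {i j : ι} {l : ℕ} (hi : (S.p i : ℕ) = l + 1)
    (hj : S.p j ≤ l) (hj' : l ≤ S.q j) :
    orderKey (up l) (S.box i (l + 1)) < orderKey (up l) (S.box j l) := by
  have hle := S.p_le_q i
  have hi1 : (S.p i : ℕ) ≤ l + 1 := hi.le
  have hi2 : l + 1 ≤ (S.q i : ℕ) := by rw [← hi]; exact hle
  have hb := S.box_mem i (l + 1) hi1 hi2
  have hc := S.content_box i (l + 1) hi1 hi2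
  have hb' := S.box_mem j l hj hj'
  have hc' := S.content_box j l hj hj'
  have hprev : ∀ b : Box, nextBox (up l) b = S.box i (l + 1) → b ∉ D := by
    intro b hnb hbD
    have hcb : boxContent b = off + l := by
      rw [← hnb] at hc
      simp only [nextBox, boxContent] at hc ⊢
      split_ifs at hc <;> simp at hc <;> omega
    obtain ⟨k, hk, hk', rfl⟩ := S.exists_box_at hbD hcb
    have hlt := S.lt_q_of_next_mem k l hk hk' (by rw [hnb]; exact hb)
    have heq := S.box_succ k l hk hlt
    rw [hnb] at heq
    have := S.box_inj k i (l + 1) (by omega) hlt hi1 hi2 heq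
    subst this
    omega
  by_contra hcon
  rw [not_lt] at hcon
  simp only [boxContent, orderKey, nextBox] at *
  push_cast at hc
  cases hu : up l <;> simp only [hu, if_true, if_false, Bool.false_eq_true] at *
  · refine hprev ((S.box i (l + 1)).1, (S.box i (l + 1)).2 - 1) (by simp) ?_
    apply S.convex _ hb' _ hb <;> simp only <;> omega
  · refine hprev ((S.box i (l + 1)).1 + 1, (S.box i (l + 1)).2) (by simp) ?_
    apply S.convex _ hb _ hb' <;> simp only <;> omega

/-- A strip ending at level `l` follows the strips passing through level `l + 1`. -/
theorem orderKey_lt_end {i j : ι} {l : ℕ} (hi : (S.q i : ℕ) = l)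
    (hj : S.p j ≤ l + 1) (hj' : l + 1 ≤ S.q j) :
    orderKey (up l) (S.box j (l + 1)) < orderKey (up l) (S.box i l) := by
  have hle : (S.p i : ℕ) ≤ S.q i := S.p_le_q i
  have hi1 : (S.p i : ℕ) ≤ l := by omega
  have hi2 : l ≤ (S.q i : ℕ) := by omega
  have hb := S.box_mem i l hi1 hi2
  have hc := S.content_box i l hi1 hi2
  have hb' := S.box_mem j (l + 1) hj hj'
  have hc' := S.content_box j (l + 1) hj hj'
  have hnext : nextBox (up l) (S.box i l) ∉ D := by
    intro h
    have := S.lt_q_of_next_mem i l hi1 hi2 h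
    omega
  by_contra hcon
  rw [not_lt] at hcon
  apply hnext
  simp only [boxContent, orderKey, nextBox] at *
  push_cast at hc'
  cases hu : up l <;> simp only [hu, if_true, if_false, Bool.false_eq_true] at *
  · apply S.convex _ hb _ hb' <;> simp only <;> omega
  · apply S.convex _ hb' _ hb <;> simp only <;> omega

theorem orderKey_nextBox (u : Bool) (b : Box) : orderKey u (nextBox u b) = orderKey u b := by
  cases u <;> simp [orderKey, nextBox]

theorem orderKey_box_succ {i : ι} {l : ℕ} (hi : S.p i ≤ l) (hi' : l < S.q i) :
    orderKey (up l) (S.box i (l + 1)) = orderKey (up l) (S.box i l) := by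
  rw [S.box_succ i l hi hi', orderKey_nextBox]

open PathState

variable {N : ℕ}

/-- The states at level `l` of the strips when their boxes at that level carry the values `x`. -/
def stateAt (l : ℕ) (x : ι → Fin N) (i : ι) : PathState N L :=
  if l < S.p i then src (S.p i) else if (S.q i : ℕ) < l then snk (S.q i) else val (x i)

/-- The values `x` increase down the diagonal at level `l`. -/
def SortedAt (l : ℕ) (x : ι → Fin N) : Prop :=
  ∀ i j, S.p i ≤ l → l ≤ S.q i → S.p j ≤ l → l ≤ S.q j →
    (S.box i l).1 < (S.box j l).1 → x i < x j

/-- The values `x` at level `l` and `y` at level `l + 1` interlace. -/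
def InterlaceAt (l : ℕ) (x y : ι → Fin N) : Prop :=
  (∀ i, S.p i ≤ l → l < S.q i → rowKey (up l) (x i) ≤ colKey (up l) (y i)) ∧
  ∀ i j, S.p i ≤ l + 1 → l + 1 ≤ S.q i → S.p j ≤ l → l ≤ S.q j →
    orderKey (up l) (S.box i (l + 1)) < orderKey (up l) (S.box j l) →
    colKey (up l) (y i) < rowKey (up l) (x j)

theorem stateAt_of_lt {l : ℕ} {x : ι → Fin N} {i : ι} (h : l < S.p i) :
    S.stateAt l x i = src (S.p i) := by simp [stateAt, h]

theorem stateAt_of_gt {l : ℕ} {x : ι → Fin N} {i : ι} (h : (S.q i : ℕ) < l) :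
    S.stateAt l x i = snk (S.q i) := by
  have : (S.p i : ℕ) ≤ S.q i := S.p_le_q i
  simp [stateAt, h, show ¬ l < S.p i by omega]

theorem stateAt_of_mem {l : ℕ} {x : ι → Fin N} {i : ι} (h : S.p i ≤ l) (h' : l ≤ S.q i) :
    S.stateAt l x i = val (x i) := by
  simp [stateAt, not_lt.2 h, not_lt.2 h']

theorem SortedAt.rowKey_lt {l : ℕ} {x : ι → Fin N} (hx : S.SortedAt l x) (u : Bool) {i j : ι}
    (hi : S.p i ≤ l) (hi' : l ≤ S.q i) (hj : S.p j ≤ l) (hj' : l ≤ S.q j)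
    (h : orderKey u (S.box i l) < orderKey u (S.box j l)) :
    rowKey u (x i) < rowKey u (x j) ∧ colKey u (x i) < colKey u (x j) := by
  have h1 := S.content_box i l hi hi'
  have h2 := S.content_box j l hj hj'
  simp only [boxContent, orderKey, rowKey, colKey] at *
  cases u <;> simp only [if_true, if_false, Bool.false_eq_true] at *
  · have := hx i j hi hi' hj hj' h
    omega
  · have := hx j i hj hj' hi hi' (by omega)
    omega

theorem stateAt_injective {l : ℕ} {x : ι → Fin N} (hx : S.SortedAt l x) :
    Function.Injective (S.stateAt l x) := by
  intro i j h
  rcases lt_or_ge l (S.p i : ℕ) with hi | hi <;> rcases lt_or_ge l (S.p j : ℕ) with hj | hj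
  · rw [S.stateAt_of_lt hi, S.stateAt_of_lt hj] at h
    exact S.p_inj (by simpa using h)
  · rw [S.stateAt_of_lt hi] at h
    rcases lt_or_ge (S.q j : ℕ) l with hj' | hj'
    · simp [S.stateAt_of_gt hj'] at h
    · simp [S.stateAt_of_mem hj hj'] at h
  · rw [S.stateAt_of_lt hj] at h
    rcases lt_or_ge (S.q i : ℕ) l with hi' | hi'
    · simp [S.stateAt_of_gt hi'] at h
    · simp [S.stateAt_of_mem hi hi'] at h
  · rcases lt_or_ge (S.q j : ℕ) l with hj' | hj' <;> rcases lt_or_ge (S.q i : ℕ) l with hi' | hi'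
    · rw [S.stateAt_of_gt hi', S.stateAt_of_gt hj'] at h
      exact S.q_inj (by simpa using h)
    · simp [S.stateAt_of_gt hj', S.stateAt_of_mem hi hi'] at h
    · simp [S.stateAt_of_gt hi', S.stateAt_of_mem hj hj'] at h
    · rw [S.stateAt_of_mem hi hi', S.stateAt_of_mem hj hj'] at h
      have h : x i = x j := by simpa using h
      rcases lt_trichotomy (S.box i l).1 (S.box j l).1 with hlt | heq | hlt
      · exact absurd h (hx i j hi hi' hj hj' hlt).ne
      · exact S.orderKey_inj false hi hi' hj hj' (by simpa [orderKey] using heq)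
      · exact absurd h (hx j i hj hj' hi hi' hlt).ne'

open Classical in
/-- The minor of the step matrix between two sorted states is the interlacing indicator. -/
theorem det_stepMatrix {R : Type*} [CommRing R] [Fintype ι] [DecidableEq ι] (l : ℕ)
    (x y : ι → Fin N) (hx : S.SortedAt l x) (hy : S.SortedAt (l + 1) y) :
    ((stepMatrix up R l).submatrix (S.stateAt l x) (S.stateAt (l + 1) y)).det =
      if S.InterlaceAt l x y then 1 else 0 := by
  have hpq : ∀ i, (S.p i : ℕ) ≤ S.q i := fun i => S.p_le_q i
  let act : ι → Prop := fun i => (S.p i : ℕ) ≤ l + 1 ∧ l ≤ (S.q i : ℕ)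
  let ξ : ι → ℤ := fun i => if S.p i ≤ l then rowKey (up l) (x i) else -(N + 5)
  let η : ι → ℤ := fun i => if l + 1 ≤ S.q i then colKey (up l) (y i) else N + 5
  let o : ι → ℤ := fun i =>
    if S.p i ≤ l then orderKey (up l) (S.box i l) else orderKey (up l) (S.box i (l + 1))
  have oval : ∀ i, S.p i ≤ l → o i = orderKey (up l) (S.box i l) := fun i h => if_pos h
  have oval' : ∀ i, l + 1 ≤ S.q i → o i = orderKey (up l) (S.box i (l + 1)) := by
    intro i h
    by_cases hp : S.p i ≤ l
    · rw [oval i hp, S.orderKey_box_succ hp h]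
    · exact if_neg hp
  have ξval : ∀ i, S.p i ≤ l → ξ i = rowKey (up l) (x i) := fun i h => if_pos h
  have ξval' : ∀ i, ¬ S.p i ≤ l → ξ i = -(N + 5) := fun i h => if_neg h
  have ηval : ∀ i, l + 1 ≤ S.q i → η i = colKey (up l) (y i) := fun i h => if_pos h
  have ηval' : ∀ i, ¬ l + 1 ≤ S.q i → η i = N + 5 := fun i h => if_neg h
  have rowb : ∀ z : Fin N, -(N + 5 : ℤ) < rowKey (up l) z ∧ rowKey (up l) z < N + 5 := by
    intro z
    have := z.2
    simp only [rowKey]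
    split_ifs <;> constructor <;> omega
  have colb : ∀ z : Fin N, -(N + 5 : ℤ) < colKey (up l) z ∧ colKey (up l) z < N + 5 := by
    intro z
    have := z.2
    simp only [colKey]
    split_ifs <;> constructor <;> omega
  have startmin : ∀ i j, act i → act j → ¬ S.p i ≤ l → j ≠ i → o i < o j := by
    intro i j hi hj hpi hne
    have hpi' : (S.p i : ℕ) = l + 1 := le_antisymm hi.1 (by omega)
    have hpj : S.p j ≤ l := by
      by_contra hpj
      exact hne (S.p_inj (Fin.ext (by have := hj.1; omega)))
    rw [oval j hpj, oval' i (by rw [← hpi']; exact hpq i)]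
    exact S.orderKey_start_lt hpi' hpj hj.2
  have endmax : ∀ i j, act i → act j → ¬ l + 1 ≤ S.q i → j ≠ i → o j < o i := by
    intro i j hi hj hqi hne
    have hqi' : (S.q i : ℕ) = l := le_antisymm (by omega) hi.2
    have hqj : l + 1 ≤ S.q j := by
      by_contra hqj
      exact hne (S.q_inj (Fin.ext (by have := hj.2; omega)))
    rw [oval i (by rw [← hqi']; exact hpq i), oval' j hqj]
    exact S.orderKey_lt_end hqi' hj.1 hqj
  have key := det_interlace act ξ η o (R := R) ?_ ?_ ?_
    ((stepMatrix up R l).submatrix (S.stateAt l x) (S.stateAt (l + 1) y)) ?_ ?_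
  · rw [key]
    refine if_congr ?_ rfl rfl
    constructor
    · rintro ⟨h1, h2⟩
      refine ⟨fun i hi hi' => ?_, fun i j hi hi' hj hj' hij => ?_⟩
      · rw [← ξval i hi, ← ηval i hi']
        exact h1 i ⟨by omega, by omega⟩
      · rw [← ξval j hj, ← ηval i hi']
        exact h2 i j ⟨hi, by omega⟩ ⟨by omega, hj'⟩ (by rwa [oval' i hi', oval j hj])
    · rintro ⟨h1, h2⟩
      refine ⟨fun i hi => ?_, fun i j hi hj hij => ?_⟩
      · by_cases hp : S.p i ≤ l <;> by_cases hq : l + 1 ≤ (S.q i : ℕ)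
        · rw [ξval i hp, ηval i hq]
          exact h1 i hp hq
        · rw [ξval i hp, ηval' i hq]
          exact (rowb _).2.le
        · rw [ξval' i hp, ηval i hq]
          exact (colb _).1.le
        · rw [ξval' i hp, ηval' i hq]
          omega
      · have hne : j ≠ i := by rintro rfl; exact lt_irrefl _ hij
        have hq : l + 1 ≤ (S.q i : ℕ) := by
          by_contra hq
          exact lt_asymm hij (endmax i j hi hj hq hne)
        have hp : S.p j ≤ l := by
          by_contra hp
          exact lt_asymm hij (startmin j i hj hi hp hne.symm)
        rw [ηval i hq, ξval j hp]
        exact h2 i j hi.1 hq hp hj.2 (by rwa [← oval' i hq, ← oval j hp])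
  · intro i j hi hj hij
    by_contra hne
    by_cases hpi : S.p i ≤ l
    · by_cases hpj : S.p j ≤ l
      · rw [oval i hpi, oval j hpj] at hij
        exact hne (S.orderKey_inj _ hpi hi.2 hpj hj.2 hij)
      · exact (startmin j i hj hi hpj hne).ne' hij
    · exact (startmin i j hi hj hpi (Ne.symm hne)).ne hij
  · intro i j hi hj hij
    have hne : i ≠ j := by rintro rfl; exact lt_irrefl _ hij
    have hpj : S.p j ≤ l := by
      by_contra hpj
      exact lt_asymm hij (startmin j i hj hi hpj hne)
    rw [ξval j hpj]
    by_cases hpi : S.p i ≤ l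
    · rw [ξval i hpi]
      rw [oval i hpi, oval j hpj] at hij
      exact (SortedAt.rowKey_lt S hx _ hpi hi.2 hpj hj.2 hij).1
    · rw [ξval' i hpi]
      exact (rowb _).1
  · intro i j hi hj hij
    have hne : j ≠ i := by rintro rfl; exact lt_irrefl _ hij
    have hqi : l + 1 ≤ S.q i := by
      by_contra hqi
      exact lt_asymm hij (endmax i j hi hj hqi hne)
    rw [ηval i hqi]
    by_cases hqj : l + 1 ≤ S.q j
    · rw [ηval j hqj]
      rw [oval' i hqi, oval' j hqj] at hij
      exact (SortedAt.rowKey_lt S hy _ hi.1 hqi hj.1 hqj hij).2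
    · rw [ηval' j hqj]
      exact (colb _).2
  · intro i j hi hj
    rw [Matrix.submatrix_apply]
    by_cases hpi : S.p i ≤ l <;> by_cases hqj : l + 1 ≤ (S.q j : ℕ)
    · rw [ξval i hpi, ηval j hqj, S.stateAt_of_mem hpi hi.2, S.stateAt_of_mem hj.1 hqj]
      rfl
    · have hq : (S.q j : ℕ) = l := le_antisymm (by omega) hj.2
      rw [ξval i hpi, ηval' j hqj, S.stateAt_of_mem hpi hi.2, S.stateAt_of_gt (by omega),
        if_pos (rowb _).2.le]
      simp [stepMatrix, hq]
    · have hp : (S.p i : ℕ) = l + 1 := le_antisymm hi.1 (by omega)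
      rw [ξval' i hpi, ηval j hqj, S.stateAt_of_lt (by omega), S.stateAt_of_mem hj.1 hqj,
        if_pos (colb _).1.le]
      simp [stepMatrix, hp]
    · have hp : (S.p i : ℕ) = l + 1 := le_antisymm hi.1 (by omega)
      have hq : (S.q j : ℕ) = l := le_antisymm (by omega) hj.2
      rw [ξval' i hpi, ηval' j hqj, S.stateAt_of_lt (by omega), S.stateAt_of_gt (by omega),
        if_pos (by omega)]
      simp [stepMatrix, hp, hq]
  · intro i j hij
    rw [Matrix.submatrix_apply]
    have hpi := hpq i
    have hpj := hpq j
    simp only [act] at hij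
    have e1 : S.p i = S.p j ↔ i = j := S.p_inj.eq_iff
    have e2 : S.q i = S.q j ↔ i = j := S.q_inj.eq_iff
    by_cases hi1 : l < S.p i
    · rw [S.stateAt_of_lt hi1]
      by_cases hj1 : l + 1 < S.p j
      · rw [S.stateAt_of_lt hj1]
        simp only [stepMatrix, e1]
        refine if_congr ⟨And.left, ?_⟩ rfl rfl
        rintro rfl
        exact ⟨rfl, hj1⟩
      · by_cases hj2 : (S.q j : ℕ) < l + 1
        · rw [S.stateAt_of_gt hj2]
          simp only [stepMatrix]
          refine if_congr ⟨fun h => by omega, ?_⟩ rfl rfl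
          rintro rfl
          omega
        · rw [S.stateAt_of_mem (by omega) (by omega)]
          simp only [stepMatrix]
          refine if_congr ⟨fun h => by omega, ?_⟩ rfl rfl
          rintro rfl
          omega
    · by_cases hi2 : (S.q i : ℕ) < l
      · rw [S.stateAt_of_gt hi2]
        have hne : ∀ h : (l + 1 ≤ S.q j), i ≠ j := by
          rintro h rfl
          omega
        by_cases hj1 : l + 1 < S.p j
        · rw [S.stateAt_of_lt hj1, if_neg (hne (by omega))]
          rfl
        · by_cases hj2 : (S.q j : ℕ) < l + 1
          · rw [S.stateAt_of_gt hj2]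
            simp only [stepMatrix, e2]
            exact if_congr ⟨And.left, fun h => ⟨h, hi2⟩⟩ rfl rfl
          · rw [S.stateAt_of_mem (by omega) (by omega), if_neg (hne (by omega))]
            rfl
      · have hne : i ≠ j := by
          rintro rfl
          omega
        rw [S.stateAt_of_mem (by omega) (by omega), if_neg hne]
        by_cases hj1 : l + 1 < S.p j
        · rw [S.stateAt_of_lt hj1]
          rfl
        · rw [S.stateAt_of_gt (by omega)]
          simp only [stepMatrix]
          rw [if_neg (by omega)]

end StripDecomposition

namespace StripDecomposition

open PathState

variable {ι : Type} {L : ℕ} {D : Finset Box} {up : ℕ → Bool} {off : ℤ}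
  (S : StripDecomposition ι L D up off) {N : ℕ} {R : Type*} [CommRing R] (X : ℕ → R)

open Classical in
/-- The sorted states at level `l`. -/
def sortedStates [Fintype ι] (N l : ℕ) : Finset (ι → PathState N L) :=
  Finset.univ.filter fun g => ∃ x, S.SortedAt l x ∧ g = S.stateAt l x

theorem mem_sortedStates [Fintype ι] {l : ℕ} {g : ι → PathState N L} :
    g ∈ S.sortedStates N l ↔ ∃ x, S.SortedAt l x ∧ g = S.stateAt l x := by
  simp [sortedStates]

theorem stateAt_eq_snk {l : ℕ} {x : ι → Fin N} {i : ι} {q : Fin L}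
    (h : S.stateAt l x i = snk q) : q = S.q i ∧ (S.q i : ℕ) < l := by
  unfold stateAt at h
  split_ifs at h with h1 h2
  exact ⟨(PathState.snk.inj h).symm, h2⟩

theorem stateAt_eq_val {l : ℕ} {x : ι → Fin N} {i : ι} {v : Fin N}
    (h : S.stateAt l x i = val v) : v = x i ∧ S.p i ≤ l ∧ l ≤ S.q i := by
  unfold stateAt at h
  split_ifs at h with h1 h2
  exact ⟨(PathState.val.inj h).symm, not_lt.1 h1, not_lt.1 h2⟩

theorem sortedStates_unique [Fintype ι] {l : ℕ} {g g' : ι → PathState N L}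
    (hg : g ∈ S.sortedStates N l) (hg' : g' ∈ S.sortedStates N l) (π : Equiv.Perm ι)
    (h : g ∘ π = g') : g = g' := by
  classical
  obtain ⟨x, hx, rfl⟩ := S.mem_sortedStates.1 hg
  obtain ⟨y, hy, rfl⟩ := S.mem_sortedStates.1 hg'
  have key := sorted_unique (Finset.univ.filter fun i => S.p i ≤ l ∧ l ≤ (S.q i : ℕ))
    (fun i => (S.box i l).1) ?_ x y ?_ ?_ ?_ ?_
  · funext i
    by_cases h1 : l < S.p i
    · rw [S.stateAt_of_lt h1, S.stateAt_of_lt h1]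
    · by_cases h2 : (S.q i : ℕ) < l
      · rw [S.stateAt_of_gt h2, S.stateAt_of_gt h2]
      · have hi := not_lt.1 h1
        have hi' := not_lt.1 h2
        rw [S.stateAt_of_mem hi hi', S.stateAt_of_mem hi hi', key i (by simp [hi, hi'])]
  · intro i hi j hj hij
    simp only [Finset.coe_filter, Finset.mem_univ, true_and, Set.mem_ofPred_eq] at hi hj
    exact S.orderKey_inj false hi.1 hi.2 hj.1 hj.2 (by simpa [orderKey] using hij)
  · intro i hi j hj hij
    simp only [Finset.mem_filter, Finset.mem_univ, true_and] at hi hj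
    exact hx i j hi.1 hi.2 hj.1 hj.2 hij
  · intro i hi j hj hij
    simp only [Finset.mem_filter, Finset.mem_univ, true_and] at hi hj
    exact hy i j hi.1 hi.2 hj.1 hj.2 hij
  · intro i hi
    simp only [Finset.mem_filter, Finset.mem_univ, true_and] at hi ⊢
    have := congrFun h (π⁻¹ i)
    rw [Function.comp_apply, ← Equiv.Perm.mul_apply, mul_inv_cancel, Equiv.Perm.one_apply,
      S.stateAt_of_mem hi.1 hi.2] at this
    obtain ⟨h1, h2⟩ := S.stateAt_eq_val this.symm
    exact ⟨π⁻¹ i, h2, h1.symm⟩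
  · intro i hi
    simp only [Finset.mem_filter, Finset.mem_univ, true_and] at hi ⊢
    have := congrFun h i
    rw [Function.comp_apply, S.stateAt_of_mem hi.1 hi.2] at this
    obtain ⟨h1, h2⟩ := S.stateAt_eq_val this
    exact ⟨π i, h2, h1.symm⟩

open Finset in
theorem sortedStates_cover [Fintype ι] [DecidableEq ι] [NeZero N] {l : ℕ}
    {g' : ι → PathState N L} (hg' : g' ∈ S.sortedStates N (l + 1)) (g : ι → PathState N L)
    (hg : Function.Injective g)
    (hA : ((pathGF up X l).submatrix (fun j => src (S.p j)) g).det ≠ 0)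
    (hB : ∀ i, transfer up X l (g i) (g' i) ≠ 0) :
    ∃ g₀ ∈ S.sortedStates N l, ∃ π : Equiv.Perm ι, g = g₀ ∘ π := by
  classical
  obtain ⟨y, hy, rfl⟩ := S.mem_sortedStates.1 hg'
  have hpq : ∀ i, (S.p i : ℕ) ≤ S.q i := fun i => S.p_le_q i
  have c1 : ∀ i p', g i = src p' → ∃ j, p' = S.p j ∧ l < S.p j := by
    intro i p' hi
    by_contra hcon
    push Not at hcon
    refine hA (Matrix.det_eq_zero_of_column_eq_zero i fun j => ?_)
    rw [Matrix.submatrix_apply, hi]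
    by_cases hj : S.p j = p'
    · subst hj
      exact pathGF_src_src_of_le up X (S.p_pos j) (hcon j rfl)
    · exact pathGF_src_src_of_ne up X hj
  have c2 : ∀ j, l < S.p j → ∃ i, g i = src (S.p j) := by
    intro j hj
    by_contra hcon
    push Not at hcon
    refine hA (Matrix.det_eq_zero_of_row_eq_zero j fun i => ?_)
    rw [Matrix.submatrix_apply, pathGF_src_of_lt up X hj, if_neg (hcon i)]
  have c3 : ∀ i q', g i = snk q' → q' = S.q i ∧ (S.q i : ℕ) < l := by
    intro i q' hi
    have hz : stepMatrix up R l (g i) (S.stateAt (l + 1) y i) ≠ 0 := right_ne_zero_of_mul (hB i)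
    rw [hi] at hz
    cases hs : S.stateAt (l + 1) y i with
    | val v => simp [hs, stepMatrix] at hz
    | src p' => simp [hs, stepMatrix] at hz
    | snk q'' =>
      have hq : q' = q'' ∧ (q' : ℕ) < l := by
        by_contra hc
        simp [hs, stepMatrix, hc] at hz
      obtain ⟨rfl, hlt⟩ := hq
      obtain ⟨rfl, -⟩ := S.stateAt_eq_snk hs
      exact ⟨rfl, hlt⟩
  have c4 : ∀ i, (S.q i : ℕ) < l → g i = snk (S.q i) := by
    intro i hi
    have hz : stepMatrix up R l (g i) (S.stateAt (l + 1) y i) ≠ 0 := right_ne_zero_of_mul (hB i)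
    rw [S.stateAt_of_gt (by omega)] at hz
    cases hs : g i with
    | val v => simp [hs, stepMatrix, hi.ne] at hz
    | src p' => simp [hs, stepMatrix, hi.ne] at hz
    | snk q'' => rw [(c3 i q'' hs).1]
  let U := univ.filter fun i => l < (S.p i : ℕ)
  let W := univ.filter fun i => (S.q i : ℕ) < l
  let I := univ.filter fun i => S.p i ≤ l ∧ l ≤ (S.q i : ℕ)
  let V := univ.filter fun v : Fin N => ∃ i, g i = val v
  have hU : (U.image fun i => (src (S.p i) : PathState N L)).card = U.card :=
    card_image_of_injective _ fun i j h => S.p_inj (PathState.src.inj h)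
  have hW : (W.image fun i => (snk (S.q i) : PathState N L)).card = W.card :=
    card_image_of_injective _ fun i j h => S.q_inj (PathState.snk.inj h)
  have hV : (V.image (val : Fin N → PathState N L)).card = V.card :=
    card_image_of_injective _ fun i j h => PathState.val.inj h
  have himg : univ.image g = (U.image fun i => (src (S.p i) : PathState N L)) ∪
      ((W.image fun i => (snk (S.q i) : PathState N L)) ∪ V.image val) := by
    ext z
    simp only [mem_image, mem_univ, true_and, mem_union, U, W, V, mem_filter]
    constructor
    · rintro ⟨i, rfl⟩
      cases hs : g i with
      | val v => exact Or.inr (Or.inr ⟨v, ⟨i, hs⟩, rfl⟩)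
      | src p' =>
        obtain ⟨j, rfl, hj⟩ := c1 i p' hs
        exact Or.inl ⟨j, hj, rfl⟩
      | snk q' =>
        obtain ⟨rfl, hq⟩ := c3 i q' hs
        exact Or.inr (Or.inl ⟨i, hq, rfl⟩)
    · rintro (⟨j, hj, rfl⟩ | ⟨i, hi, rfl⟩ | ⟨v, hv, rfl⟩)
      · exact c2 j hj
      · exact ⟨i, c4 i hi⟩
      · exact hv
  have hcardV : V.card = I.card := by
    have h1 : (univ.image g).card = Fintype.card ι := card_image_of_injective _ hg
    rw [himg, card_union_of_disjoint, card_union_of_disjoint, hU, hW, hV] at h1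
    · have h2 : (univ : Finset ι) = U ∪ (W ∪ I) := by
        ext i
        simp only [mem_univ, mem_union, U, W, I, mem_filter, true_and, true_iff]
        omega
      rw [← card_univ, h2, card_union_of_disjoint, card_union_of_disjoint] at h1
      · omega
      · rw [disjoint_left]
        intro i
        simp only [W, I, mem_filter, mem_univ, true_and]
        omega
      · rw [disjoint_left]
        intro i
        have := hpq i
        simp only [U, W, I, mem_filter, mem_univ, true_and, mem_union]
        omega
    · rw [disjoint_left]
      intro z
      simp only [mem_image]
      rintro ⟨i, -, rfl⟩ ⟨v, -, h⟩
      cases h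
    · rw [disjoint_left]
      intro z
      simp only [mem_image, mem_union]
      rintro ⟨i, -, rfl⟩ (⟨v, -, h⟩ | ⟨v, -, h⟩) <;> cases h
  obtain ⟨x, hxV, hx⟩ := exists_sorted_of_card_eq I (fun i => (S.box i l).1) (by
    intro i hi j hj hij
    simp only [I, coe_filter, mem_univ, true_and, Set.mem_ofPred_eq] at hi hj
    exact S.orderKey_inj false hi.1 hi.2 hj.1 hj.2 (by simpa [orderKey] using hij)) V hcardV
  have hsorted : S.SortedAt l x := fun i j hi hi' hj hj' hij =>
    hx i (by simp [I, hi, hi']) j (by simp [I, hj, hj']) hij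
  refine ⟨S.stateAt l x, S.mem_sortedStates.2 ⟨x, hsorted, rfl⟩, ?_⟩
  have hex : ∀ i, ∃ k, S.stateAt l x i = g k := by
    intro i
    by_cases h1 : l < S.p i
    · obtain ⟨k, hk⟩ := c2 i h1
      exact ⟨k, by rw [S.stateAt_of_lt h1, hk]⟩
    · by_cases h2 : (S.q i : ℕ) < l
      · exact ⟨i, by rw [S.stateAt_of_gt h2, c4 i h2]⟩
      · obtain ⟨k, hk⟩ : ∃ k, g k = val (x i) := by
          simpa [V] using hxV i (by simp [I]; omega)
        exact ⟨k, by rw [S.stateAt_of_mem (by omega) (by omega), hk]⟩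
  choose k hk using hex
  have hkinj : Function.Injective k := fun i j hij =>
    S.stateAt_injective hsorted (by rw [hk, hk, hij])
  let π := Equiv.ofBijective k (Finite.injective_iff_bijective.1 hkinj)
  refine ⟨π.symm, funext fun i => ?_⟩
  rw [Function.comp_apply, hk]
  exact congrArg g (π.apply_symm_apply i).symm

end StripDecomposition

/-- Entries weakly increase along the rows of `D` and strictly increase down its columns. -/
def IsTableau {N : ℕ} (D : Finset Box) (t : Box → Fin N) : Prop :=
  (∀ b ∈ D, (b.1, b.2 + 1) ∈ D → t b ≤ t (b.1, b.2 + 1)) ∧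
  ∀ b ∈ D, (b.1 + 1, b.2) ∈ D → t b < t (b.1 + 1, b.2)

namespace StripDecomposition

open PathState

variable {ι : Type} {L : ℕ} {D : Finset Box} {up : ℕ → Bool} {off : ℤ}
  (S : StripDecomposition ι L D up off) {N : ℕ} {R : Type*} [CommRing R] (X : ℕ → R)

theorem exists_index : ∃ (s : D → ι) (lev : D → ℕ),
    (∀ b : D, S.p (s b) ≤ lev b ∧ lev b ≤ S.q (s b) ∧ S.box (s b) (lev b) = b) ∧
    ∀ (b : D) i (l : ℕ), S.p i ≤ l → l ≤ S.q i → S.box i l = b → s b = i ∧ lev b = l := by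
  choose s lev h using fun b : D => S.exists_box b b.2
  refine ⟨s, lev, h, fun b i l hi hi' hb => ?_⟩
  have h1 := S.content_box i l hi hi'
  have h2 := S.content_box _ _ (h b).1 (h b).2.1
  rw [(h b).2.2] at h2
  rw [hb] at h1
  have hl : lev b = l := by omega
  refine ⟨?_, hl⟩
  subst hl
  exact S.box_inj _ _ _ (h b).1 (h b).2.1 hi hi' ((h b).2.2.trans hb.symm)

theorem lt_of_isTableau (S : StripDecomposition ι L D up off) {t : Box → Fin N}
    (ht : IsTableau D t) {b c : Box} (hb : b ∈ D) (hc : c ∈ D) (h1 : b.1 ≤ c.1) (h2 : b.2 ≤ c.2) :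
    t b ≤ t c ∧ (b.1 < c.1 → t b < t c) := by
  obtain ⟨m, hm⟩ := Int.eq_ofNat_of_zero_le (sub_nonneg.2 h1)
  obtain ⟨n, hn⟩ := Int.eq_ofNat_of_zero_le (sub_nonneg.2 h2)
  induction m generalizing c with
  | zero =>
    refine ⟨?_, by omega⟩
    induction n generalizing c with
    | zero =>
      have : b = c := Prod.ext (by push_cast at *; omega) (by push_cast at *; omega)
      rw [this]
    | succ n ih =>
      push_cast at *
      have hc' : (c.1, c.2 - 1) ∈ D := by
        apply S.convex b hb c hc <;> simp only <;> omega
      have := ht.1 _ hc' (by simpa using hc)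
      refine (ih hc' h1 ?_ hm ?_).trans (by simpa using this) <;> simp only <;> omega
  | succ m ih =>
    push_cast at *
    have hc' : (c.1 - 1, c.2) ∈ D := by
      apply S.convex b hb c hc <;> simp only <;> omega
    have hlt : t (c.1 - 1, c.2) < t c := by
      have := ht.2 _ hc' (by simpa using hc)
      simpa using this
    have h := (ih hc' (by simp only; omega) h2 (by simp only; omega) hn).1.trans_lt hlt
    exact ⟨h.le, fun _ => h⟩

theorem sortedAt_of_isTableau {t : Box → Fin N} (ht : IsTableau D t) (l : ℕ) :
    S.SortedAt l fun i => t (S.box i l) := by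
  intro i j hi hi' hj hj' hij
  have h1 := S.content_box i l hi hi'
  have h2 := S.content_box j l hj hj'
  simp only [boxContent] at h1 h2
  exact (S.lt_of_isTableau ht (S.box_mem i l hi hi') (S.box_mem j l hj hj') hij.le (by omega)).2 hij

theorem interlaceAt_of_isTableau {t : Box → Fin N} (ht : IsTableau D t) (l : ℕ) :
    S.InterlaceAt l (fun i => t (S.box i l)) fun i => t (S.box i (l + 1)) := by
  constructor
  · intro i hi hi'
    have hb := S.box_mem i l hi hi'.le
    have hb' := S.box_mem i (l + 1) (by omega) hi'
    have hs := S.box_succ i l hi hi'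
    rw [hs] at hb'
    simp only [hs]
    cases hu : up l <;> simp only [hu, nextBox, rowKey, colKey, if_true, if_false,
      Bool.false_eq_true] at hb' ⊢
    · have := ht.1 _ hb hb'
      omega
    · have := ht.2 _ hb' (by simpa using hb)
      simp only [sub_add_cancel, Prod.mk.eta] at this
      omega
  · intro i j hi hi' hj hj' hij
    have hb := S.box_mem j l hj hj'
    have hb' := S.box_mem i (l + 1) hi hi'
    have h1 := S.content_box j l hj hj'
    have h2 := S.content_box i (l + 1) hi hi'
    simp only [boxContent] at h1 h2
    push_cast at h2
    cases hu : up l <;> simp only [hu, orderKey, rowKey, colKey, if_true, if_false,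
      Bool.false_eq_true] at hij ⊢
    · have := (S.lt_of_isTableau ht hb' hb hij.le (by omega)).2 hij
      omega
    · have := (S.lt_of_isTableau ht hb hb' (by omega) (by omega)).1
      omega

theorem isTableau_of_interlaceAt {t : Box → Fin N} {x : ℕ → ι → Fin N}
    (hx : ∀ i (l : ℕ), S.p i ≤ l → l ≤ S.q i → t (S.box i l) = x l i)
    (h : ∀ l < L, S.InterlaceAt l (x l) (x (l + 1))) : IsTableau D t := by
  have key : ∀ b ∈ D, ∀ c ∈ D, boxContent c = boxContent b + 1 → ∃ l,
      (nextBox (up l) b = c → rowKey (up l) (t b) ≤ colKey (up l) (t c)) ∧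
      (orderKey (up l) c < orderKey (up l) b → colKey (up l) (t c) < rowKey (up l) (t b)) := by
    intro b hb c hc hbc
    obtain ⟨i, l, hi, hi', rfl⟩ := S.exists_box b hb
    have h1 := S.content_box i l hi hi'
    obtain ⟨j, hj, hj', rfl⟩ := S.exists_box_at hc (l := l + 1) (by push_cast; omega)
    obtain ⟨H1, H2⟩ := h l (by omega)
    refine ⟨l, fun hn => ?_, fun hn => ?_⟩
    · have hlt := S.lt_q_of_next_mem i l hi hi' (by rw [hn]; exact hc)
      have := H1 i hi hlt
      rwa [← hn, ← S.box_succ i l hi hlt, hx i l hi hi', hx i (l + 1) (by omega) hlt]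
    · rw [hx i l hi hi', hx j (l + 1) hj hj']
      exact H2 j i hj hj' hi hi' hn
  constructor
  · intro b hb hc
    obtain ⟨l, H1, H2⟩ := key b hb _ hc (by simp only [boxContent]; omega)
    cases hu : up l <;> simp only [hu, nextBox, orderKey, rowKey, colKey, if_true, if_false,
      Bool.false_eq_true] at H1 H2
    · have := H1 trivial
      omega
    · have := H2 (by omega)
      omega
  · intro b hb hc
    obtain ⟨l, H1, H2⟩ := key _ hc b hb (by simp only [boxContent]; omega)
    cases hu : up l <;> simp only [hu, nextBox, orderKey, rowKey, colKey, if_true, if_false,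
      Bool.false_eq_true] at H1 H2
    · have := H2 (by omega)
      omega
    · have := H1 (by simp)
      omega

theorem stateAt_congr {l : ℕ} {x y : ι → Fin N} (h : ∀ i, S.p i ≤ l → l ≤ S.q i → x i = y i) :
    S.stateAt l x = S.stateAt l y := by
  funext i
  unfold stateAt
  split_ifs with h1 h2
  · rfl
  · rfl
  · rw [h i (not_lt.1 h1) (not_lt.1 h2)]

open Classical in
theorem det_transfer [Fintype ι] [DecidableEq ι] {l : ℕ} {x y : ι → Fin N} (hx : S.SortedAt l x)
    (hy : S.SortedAt (l + 1) y) :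
    ((transfer up X l).submatrix (S.stateAt l x) (S.stateAt (l + 1) y)).det =
      (∏ i, stateWeight X (S.stateAt (l + 1) y i)) * if S.InterlaceAt l x y then 1 else 0 := by
  rw [← S.det_stepMatrix l x y hx hy, ← Matrix.det_mul_row]
  rfl

/-- The recursion over the levels for the minors of the path generating functions. -/
theorem det_pathGF_succ [Fintype ι] [DecidableEq ι] [NeZero N] (l : ℕ) {g' : ι → PathState N L}
    (hg' : g' ∈ S.sortedStates N (l + 1)) :
    ((pathGF up X (l + 1)).submatrix (fun j => src (S.p j)) g').det =
      ∑ g ∈ S.sortedStates N l, ((pathGF up X l).submatrix (fun j => src (S.p j)) g).det *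
        ((transfer up X l).submatrix g g').det := by
  have := det_mul_eq_sum_of_representatives
    ((pathGF up X l).submatrix (fun j => (src (S.p j) : PathState N L)) id)
    ((transfer up X l).submatrix id g') (S.sortedStates N l) ?_ ?_ ?_
  · rw [pathGF, ← Matrix.submatrix_mul_equiv _ _ _ (Equiv.refl (PathState N L)) g']
    exact this
  · intro g hg
    obtain ⟨x, hx, rfl⟩ := S.mem_sortedStates.1 hg
    exact S.stateAt_injective hx
  · intro g hg g' hg' π h
    exact S.sortedStates_unique hg hg' π h
  · intro g hg hA hB
    exact S.sortedStates_cover X hg' g hg hA hB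

open Finset in
theorem prod_stateWeight [Fintype ι] (t : Box → Fin N) :
    ∏ b : D, X (t b) =
      ∏ l : Fin L, ∏ i, stateWeight X (S.stateAt (l + 1) (fun i => t (S.box i (l + 1))) i) := by
  obtain ⟨s, lev, h, huniq⟩ := S.exists_index
  have hlev : ∀ b, 0 < lev b := fun b => (S.p_pos (s b)).trans_le (h b).1
  rw [← Fintype.prod_prod_type']
  refine Finset.prod_of_injOn (fun b => (⟨lev b - 1, by have := (h b).2.1; omega⟩, s b)) ?_
    (fun _ _ => mem_coe.2 (mem_univ _)) ?_ ?_
  · intro b _ c _ hbc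
    simp only [Prod.mk.injEq, Fin.mk.injEq] at hbc
    have hl : lev b = lev c := by have := hlev b; have := hlev c; omega
    apply Subtype.ext
    rw [← (h b).2.2, ← (h c).2.2, hl, hbc.2]
  · rintro ⟨l, i⟩ - hli
    rcases lt_or_ge ((l : ℕ) + 1) (S.p i) with h1 | h1
    · rw [S.stateAt_of_lt h1]
      rfl
    rcases lt_or_ge (S.q i : ℕ) (l + 1) with h2 | h2
    · rw [S.stateAt_of_gt h2]
      rfl
    refine absurd ?_ hli
    obtain ⟨e1, e2⟩ := huniq ⟨_, S.box_mem i _ h1 h2⟩ i (l + 1) h1 h2 rfl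
    exact ⟨⟨_, S.box_mem i _ h1 h2⟩, mem_coe.2 (mem_univ _), by simp [e1, e2]⟩
  · intro b _
    have e : lev b - 1 + 1 = lev b := Nat.sub_add_cancel (hlev b)
    simp only [e]
    rw [S.stateAt_of_mem (h b).1 (h b).2.1, (h b).2.2]
    rfl

end StripDecomposition

/-- Extension by zero of a filling of `D`. -/
def extendZero {N : ℕ} [NeZero N] {D : Finset Box} (t : D → Fin N) (b : Box) : Fin N :=
  if h : b ∈ D then t ⟨b, h⟩ else 0

theorem extendZero_of_mem {N : ℕ} [NeZero N] {D : Finset Box} (t : D → Fin N) {b : Box}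
    (h : b ∈ D) : extendZero t b = t ⟨b, h⟩ := dif_pos h

theorem extendZero_coe {N : ℕ} [NeZero N] {D : Finset Box} (t : D → Fin N) (b : D) :
    extendZero t b = t b := extendZero_of_mem t b.2

namespace StripDecomposition

open PathState

variable {ι : Type} {L : ℕ} {D : Finset Box} {up : ℕ → Bool} {off : ℤ}
  (S : StripDecomposition ι L D up off) {N : ℕ} {R : Type*} [CommRing R] (X : ℕ → R)

open Finset Classical in
/-- The tableaux with entries less than `N` are enumerated by a determinant of ribbon path
generating functions. -/
theorem sum_isTableau_eq_det [Fintype ι] [DecidableEq ι] [NeZero N] :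
    ∑ t : D → Fin N with IsTableau D (extendZero t), ∏ b, X (t b) =
      (Matrix.of fun j i => ribbonGF up X N (S.p j) (S.q i)).det := by
  have hsum := sum_sequences (fun l => S.sortedStates N l)
    (fun l g g' => ((transfer up X l).submatrix g g').det)
    (fun l g => ((pathGF up X l).submatrix (fun j => src (S.p j)) g).det) ?_
    (fun l g' hg' => S.det_pathGF_succ X l hg') L (fun _ => 1)
  · have hlast : ∀ x : ι → Fin N, S.stateAt L x = fun i => snk (S.q i) := fun x =>
      funext fun i => S.stateAt_of_gt (S.q i).2
    have hone : S.sortedStates N L = {fun i => snk (S.q i)} := by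
      ext g
      rw [S.mem_sortedStates, mem_singleton]
      constructor
      · rintro ⟨x, -, rfl⟩
        exact hlast x
      · rintro rfl
        refine ⟨fun _ => 0, fun i j hi hi' => ?_, (hlast _).symm⟩
        have := (S.q i).2
        omega
    rw [hone, sum_singleton, mul_one] at hsum
    refine Eq.trans ?_ hsum.symm
    simp only [mul_one]
    refine sum_of_injOn (fun t l => S.stateAt l fun i => extendZero t (S.box i l)) ?_ ?_ ?_ ?_
    · intro t _ t' _ h
      funext b
      obtain ⟨i, l, hi, hi', hb⟩ := S.exists_box b b.2
      have := congrFun (congrFun h ⟨l, by omega⟩) i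
      simp only [S.stateAt_of_mem hi hi', hb, extendZero_coe] at this
      exact PathState.val.inj this
    · intro t ht
      simp only [coe_filter, mem_univ, true_and, Set.mem_ofPred_eq] at ht
      refine mem_coe.2 (Fintype.mem_piFinset.2 fun l => S.mem_sortedStates.2 ⟨_, ?_, rfl⟩)
      exact S.sortedAt_of_isTableau ht l
    · intro γ hγ hnot
      by_contra hne
      have hx : ∀ l : Fin (L + 1), ∃ x, S.SortedAt l x ∧ γ l = S.stateAt l x := fun l =>
        S.mem_sortedStates.1 (Fintype.mem_piFinset.1 hγ l)
      choose x hx hγx using hx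
      let x' : ℕ → ι → Fin N := fun l => if h : l < L + 1 then x ⟨l, h⟩ else fun _ => 0
      have hx' : ∀ l (h : l < L + 1), x' l = x ⟨l, h⟩ := fun l h => dif_pos h
      have hint : ∀ l < L, S.InterlaceAt l (x' l) (x' (l + 1)) := by
        intro l hl
        by_contra hcon
        refine hne (prod_eq_zero (mem_univ ⟨l, hl⟩) ?_)
        have := S.det_transfer X (hx ⟨l, by omega⟩) (hx ⟨l + 1, by omega⟩)
        rw [← hx', ← hx', if_neg hcon, mul_zero] at this
        rw [hγx, hγx, ← this, hx', hx']
        rfl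
      obtain ⟨s, lev, h, huniq⟩ := S.exists_index
      have hlev : ∀ b, lev b < L + 1 := fun b => by have := (h b).2.1; omega
      have ht : ∀ i (l : ℕ), S.p i ≤ l → l ≤ S.q i →
          extendZero (fun b => x' (lev b) (s b)) (S.box i l) = x' l i := by
        intro i l hi hi'
        obtain ⟨e1, e2⟩ := huniq ⟨_, S.box_mem i l hi hi'⟩ i l hi hi' rfl
        rw [extendZero_of_mem _ (S.box_mem i l hi hi'), e1, e2]
      refine hnot ⟨fun b => x' (lev b) (s b), ?_, ?_⟩
      · simp only [coe_filter, mem_univ, true_and, Set.mem_ofPred_eq]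
        exact S.isTableau_of_interlaceAt ht hint
      · funext l
        rw [hγx, ← Fin.eta l l.2, ← hx' l l.2]
        exact S.stateAt_congr fun i hi hi' => ht i l hi hi'
    · intro t ht
      simp only [mem_filter, mem_univ, true_and] at ht
      have := S.prod_stateWeight X (extendZero t)
      simp only [extendZero_coe] at this
      rw [this]
      refine prod_congr rfl fun l _ => ?_
      have := S.det_transfer X (S.sortedAt_of_isTableau ht l) (S.sortedAt_of_isTableau ht (l + 1))
      rw [if_pos (S.interlaceAt_of_isTableau ht l), mul_one] at this
      exact this.symm
  · intro g hg
    obtain ⟨x, -, rfl⟩ := S.mem_sortedStates.1 hg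
    have : S.stateAt 0 x = fun i => src (S.p i) := funext fun i => S.stateAt_of_lt (S.p_pos i)
    rw [this, pathGF]
    rw [Matrix.submatrix_one _ fun i j h => S.p_inj (PathState.src.inj h), Matrix.det_one]

end StripDecomposition

/-- The boxes of a skew diagram form a convex subset for the coordinatewise order. -/
theorem IsSkewLike.convex {D : Set Box} (hD : IsSkewLike D) {a b e : Box} (ha : a ∈ D)
    (hb : b ∈ D) (h1 : a.1 ≤ e.1) (h2 : e.1 ≤ b.1) (h3 : a.2 ≤ e.2) (h4 : e.2 ≤ b.2) : e ∈ D := by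
  obtain ⟨v, lam, mu, -, hv⟩ := hD
  have hiff : ∀ b : Box, b ∈ D ↔ b + v ∈ skewCells lam mu := by
    intro b
    rw [← hv, boxTranslate, (add_left_injective v).mem_set_image]
  rw [hiff] at ha hb ⊢
  simp only [skewCells, Set.mem_ofPred_eq, Prod.fst_add, Prod.snd_add] at ha hb ⊢
  have e1 := mu.antitone (i := (a.1 + v.1).toNat) (j := (e.1 + v.1).toNat) (by omega)
  have e2 := lam.antitone (i := (e.1 + v.1).toNat) (j := (b.1 + v.1).toNat) (by omega)
  omega

theorem IsSkewShape.isSkewLike {D : Set Box} (hD : IsSkewShape D) : IsSkewLike D :=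
  ⟨0, by simpa [boxTranslate] using hD⟩

theorem IsSkewShape.finite {D : Set Box} (hD : IsSkewShape D) : D.Finite := by
  obtain ⟨lam, mu, -, rfl⟩ := hD
  obtain ⟨n, hn⟩ := lam.eventually_zero
  refine (Set.finite_Icc ((1, 1) : Box) (n, lam.part 0)).subset fun b hb => ?_
  obtain ⟨h1, h2, h3⟩ := hb
  have h4 := lam.antitone (Nat.zero_le b.1.toNat)
  have h5 : b.1 ≤ n := by
    by_contra hcon
    have := hn b.1.toNat (by omega)
    omega
  simp only [Set.mem_Icc, Prod.le_def]
  omega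

theorem EdgewiseConnected.exists_step {B : Set Box} (hB : EdgewiseConnected B) {a b : Box}
    (ha : a ∈ B) (hb : b ∈ B) {c : ℤ} (hac : boxContent a ≤ c) (hcb : c < boxContent b) :
    ∃ x ∈ B, boxContent x = c ∧ ((x.1 - 1, x.2) ∈ B ∨ (x.1, x.2 + 1) ∈ B) := by
  by_contra hcon
  refine not_le.2 hcb ?_
  have hpath := hB a ha b hb
  clear hcb hb
  induction hpath with
  | refl => exact hac
  | @tail y z _ hyz ih =>
    obtain ⟨hy, hz, hadj⟩ := hyz
    by_contra hlt
    refine hcon ⟨y, hy, ?_⟩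
    have hup : z = (y.1 - 1, y.2) → (y.1 - 1, y.2) ∈ B := fun h => h ▸ hz
    have hright : z = (y.1, y.2 + 1) → (y.1, y.2 + 1) ∈ B := fun h => h ▸ hz
    simp only [Prod.ext_iff] at hup hright
    simp only [boxContent, boxAdj] at *
    rcases hadj with ⟨h1, h2 | h2⟩ | ⟨h1, h2 | h2⟩
    · omega
    · exact ⟨by omega, Or.inr (hright ⟨by omega, by omega⟩)⟩
    · exact ⟨by omega, Or.inl (hup ⟨by omega, by omega⟩)⟩
    · omega

namespace IsBorderStrip

variable {B : Set Box}

theorem eq_or_eq_of_le (hB : IsBorderStrip B) {a b : Box} (ha : a ∈ B) (hb : b ∈ B)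
    (h1 : a.1 ≤ b.1) (h2 : a.2 ≤ b.2) : a.1 = b.1 ∨ a.2 = b.2 := by
  by_contra! hcon
  refine hB.2.2.2 a ⟨ha, ?_, ?_, ?_⟩ <;> apply hB.2.1.convex ha hb <;> simp only <;> omega

theorem eq_of_boxContent_eq (hB : IsBorderStrip B) {a b : Box} (ha : a ∈ B) (hb : b ∈ B)
    (h : boxContent a = boxContent b) : a = b := by
  simp only [boxContent] at h
  rcases le_total a.1 b.1 with hle | hle
  · have := hB.eq_or_eq_of_le ha hb hle (by omega)
    apply Prod.ext <;> omega
  · have := hB.eq_or_eq_of_le hb ha hle (by omega)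
    apply Prod.ext <;> omega

theorem next_mem (hB : IsBorderStrip B) {a b : Box} (ha : a ∈ B) (hb : b ∈ B)
    (h : boxContent a < boxContent b) : (a.1 - 1, a.2) ∈ B ∨ (a.1, a.2 + 1) ∈ B := by
  obtain ⟨x, hx, hxc, hx'⟩ := hB.2.2.1.exists_step ha hb le_rfl h
  rwa [hB.eq_of_boxContent_eq hx ha hxc] at hx'

theorem exists_of_le (hB : IsBorderStrip B) {a b : Box} (ha : a ∈ B) (hb : b ∈ B) {c : ℤ}
    (h1 : boxContent a ≤ c) (h2 : c ≤ boxContent b) : ∃ x ∈ B, boxContent x = c := by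
  rcases h2.eq_or_lt with rfl | h2
  · exact ⟨b, hb, rfl⟩
  · obtain ⟨x, hx, hxc, -⟩ := hB.2.2.1.exists_step ha hb h1 h2
    exact ⟨x, hx, hxc⟩

theorem le_of_isStartBox (hB : IsBorderStrip B) {a b : Box} (ha : IsStartBox B a) (hb : b ∈ B) :
    boxContent a ≤ boxContent b := by
  by_contra! hlt
  obtain ⟨x, hx, hxc, h | h⟩ := hB.2.2.1.exists_step hb ha.1 (c := boxContent a - 1)
    (by omega) (by omega)
  · have := hB.eq_of_boxContent_eq h ha.1 (by simp only [boxContent] at *; omega)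
    refine ha.2.2 ?_
    rwa [← this, sub_add_cancel]
  · have := hB.eq_of_boxContent_eq h ha.1 (by simp only [boxContent] at *; omega)
    refine ha.2.1 ?_
    rwa [← this, add_sub_cancel_right]

theorem le_of_isEndBox (hB : IsBorderStrip B) {a b : Box} (ha : IsEndBox B a) (hb : b ∈ B) :
    boxContent b ≤ boxContent a := by
  by_contra! hlt
  rcases hB.next_mem ha.1 hb hlt with h | h
  · exact ha.2.1 h
  · exact ha.2.2 h

theorem contents_of_hasPQ (hB : IsBorderStrip B) {p q : ℤ} (h : HasPQ B p q) :
    p ≤ q ∧ (∀ b ∈ B, p ≤ boxContent b ∧ boxContent b ≤ q) ∧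
      ∀ c, p ≤ c → c ≤ q → ∃ b ∈ B, boxContent b = c := by
  obtain ⟨⟨a, ha, rfl⟩, b, hb, rfl⟩ := h
  exact ⟨hB.le_of_isStartBox ha hb.1,
    fun x hx => ⟨hB.le_of_isStartBox ha hx, hB.le_of_isEndBox hb hx⟩,
    fun c h1 h2 => hB.exists_of_le ha.1 hb.1 h1 h2⟩

theorem hasPQ_unique (hB : IsBorderStrip B) {p q p' q' : ℤ} (h : HasPQ B p q)
    (h' : HasPQ B p' q') : p = p' ∧ q = q' := by
  obtain ⟨⟨a, ha, rfl⟩, b, hb, rfl⟩ := h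
  obtain ⟨⟨a', ha', rfl⟩, b', hb', rfl⟩ := h'
  exact ⟨le_antisymm (hB.le_of_isStartBox ha ha'.1) (hB.le_of_isStartBox ha' ha.1),
    le_antisymm (hB.le_of_isEndBox hb' hb.1) (hB.le_of_isEndBox hb hb'.1)⟩

end IsBorderStrip

open Classical in
/-- The box of content `c` of `B`. -/
def boxAt (B : Set Box) (c : ℤ) : Box :=
  if h : ∃ b ∈ B, boxContent b = c then h.choose else 0

theorem boxAt_spec {B : Set Box} {c : ℤ} (h : ∃ b ∈ B, boxContent b = c) :
    boxAt B c ∈ B ∧ boxContent (boxAt B c) = c := by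
  rw [boxAt, dif_pos h]
  exact h.choose_spec

theorem boxContent_nextBox (u : Bool) (b : Box) :
    boxContent (nextBox u b) = boxContent b + 1 := by
  cases u <;> simp only [boxContent, nextBox, if_true, if_false, Bool.false_eq_true] <;> omega

open Classical in
/-- The directions of the boxes of the strip `T`, by level. -/
def stripUp (T : Set Box) (off : ℤ) (l : ℕ) : Bool := decide (StripGoesUpAt T (off + l))

theorem IsBorderStrip.nextBox_stripUp_mem {T : Set Box} (hT : IsBorderStrip T) {off : ℤ} {l : ℕ}
    {t b : Box} (ht : t ∈ T) (htc : boxContent t = off + l) (hb : b ∈ T)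
    (hlt : off + l < boxContent b) : nextBox (stripUp T off l) t ∈ T := by
  by_cases hu : StripGoesUpAt T (off + l)
  · obtain ⟨x, hx, hxc, hx'⟩ := id hu
    rw [hT.eq_of_boxContent_eq hx ht (hxc.trans htc.symm)] at hx'
    simpa [stripUp, hu, nextBox] using hx'
  · rcases hT.next_mem ht hb (by omega) with h | h
    · exact absurd ⟨t, ht, htc, h⟩ hu
    · simpa [stripUp, hu, nextBox] using h

/-- The next box of a box of an outside decomposition, in the direction of the cutting strip, lies
in the same strip as soon as it lies in the diagram. -/
theorem IsCuttingStripOf.next_mem {D T : Set Box} {P : Set (Set Box)}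
    (hP : IsOutsideDecomposition D P) (hT : IsCuttingStripOf D P T) {θ : Set Box} (hθ : θ ∈ P)
    {off : ℤ} {l : ℕ} {x y : Box} (hx : x ∈ θ) (hxc : boxContent x = off + l) (hy : y ∈ D)
    (hyc : boxContent y = boxContent x + 1) :
    (nextBox (stripUp T off l) x ∈ D ∨ ¬ IsEndBox θ x) → nextBox (stripUp T off l) x ∈ θ := by
  intro hor
  obtain ⟨hstrip, hcov, -, hend⟩ := hP
  obtain ⟨hTs, himg, hdir⟩ := hT
  have hxD : x ∈ D := (hstrip θ hθ).2 hx
  have huniq : ∀ θ' ∈ P, x ∈ θ' → θ' = θ := fun θ' h h' => (hcov x hxD).unique ⟨h, h'⟩ ⟨hθ, hx⟩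
  obtain ⟨t, ht, htc⟩ : boxContent x ∈ boxContent '' T := himg ▸ ⟨x, hxD, rfl⟩
  obtain ⟨t', ht', htc'⟩ : boxContent y ∈ boxContent '' T := himg ▸ ⟨y, hy, rfl⟩
  have hnext := hTs.nextBox_stripUp_mem (off := off) (l := l) ht (by omega) ht' (by omega)
  obtain ⟨hup, hright⟩ := hdir t ht x hxD htc.symm
  cases hu : stripUp T off l <;>
    simp only [hu, nextBox, if_true, if_false, Bool.false_eq_true] at hnext hor ⊢
  · obtain ⟨θ', hθ', hxθ', h⟩ := hright hnext
    rw [huniq θ' hθ' hxθ'] at h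
    rcases h with h | ⟨h, hxu⟩
    · exact h
    · rcases hor with hor | hor
      · rcases hend θ hθ x h with h' | h'
        · exact absurd hxu h'
        · exact absurd hor h'
      · exact absurd h hor
  · obtain ⟨θ', hθ', hxθ', h⟩ := hup hnext
    rw [huniq θ' hθ' hxθ'] at h
    rcases h with h | ⟨h, hxu⟩
    · exact h
    · rcases hor with hor | hor
      · exact absurd hor hxu
      · exact absurd h hor

/-- An outside decomposition with a cutting strip is a strip decomposition. -/
theorem exists_stripDecomposition {D : Finset Box} (hD : IsSkewLike (D : Set Box)) {ι : Type}
    {θ : ι → Set Box} (hθinj : Function.Injective θ)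
    (hP : IsOutsideDecomposition (D : Set Box) (Set.range θ))
    {pθ qθ : ι → ℤ} (hpq : ∀ i, HasPQ (θ i) (pθ i) (qθ i))
    (hp : Function.Injective pθ) (hq : Function.Injective qθ)
    {T : Set Box} (hT : IsCuttingStripOf (D : Set Box) (Set.range θ) T) {off : ℤ} {L : ℕ}
    (hL : ∀ b ∈ D, off < boxContent b ∧ boxContent b < off + L) :
    ∃ S : StripDecomposition ι L D (stripUp T off) off,
      ∀ i, off + (S.p i : ℕ) = pθ i ∧ off + (S.q i : ℕ) = qθ i := by
  have hstrip : ∀ i, IsBorderStrip (θ i) := fun i => (hP.1 _ ⟨i, rfl⟩).1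
  have hsub : ∀ i, θ i ⊆ (D : Set Box) := fun i => (hP.1 _ ⟨i, rfl⟩).2
  have hcont := fun i => (hstrip i).contents_of_hasPQ (hpq i)
  have hbox : ∀ i c, pθ i ≤ c → c ≤ qθ i → boxAt (θ i) c ∈ θ i ∧ boxContent (boxAt (θ i) c) = c :=
    fun i c h1 h2 => boxAt_spec ((hcont i).2.2 c h1 h2)
  have hbd : ∀ i c, pθ i ≤ c → c ≤ qθ i → off < c ∧ c < off + L := by
    intro i c h1 h2
    obtain ⟨h3, h4⟩ := hbox i c h1 h2
    have := hL _ (hsub i h3)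
    rwa [h4] at this
  have hpb := fun i => hbd i _ le_rfl (hcont i).1
  have hqb := fun i => hbd i _ (hcont i).1 le_rfl
  have hbox' : ∀ i (l : ℕ), (pθ i - off).toNat ≤ l → l ≤ (qθ i - off).toNat →
      boxAt (θ i) (off + l) ∈ θ i ∧ boxContent (boxAt (θ i) (off + l)) = off + l := by
    intro i l h1 h2
    have := hpb i
    have := hqb i
    exact hbox i _ (by omega) (by omega)
  refine ⟨{
    p := fun i => ⟨(pθ i - off).toNat, by have := hpb i; omega⟩
    q := fun i => ⟨(qθ i - off).toNat, by have := hqb i; omega⟩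
    box := fun i l => boxAt (θ i) (off + l)
    p_pos := fun i => by have := hpb i; simp only; omega
    p_le_q := fun i => Fin.mk_le_mk.2 (by have := hpb i; have := (hcont i).1; omega)
    p_inj := fun i j h => hp (by have := hpb i; have := hpb j; have := Fin.mk.inj h; omega)
    q_inj := fun i j h => hq (by have := hqb i; have := hqb j; have := Fin.mk.inj h; omega)
    convex := fun a ha b hb e h1 h2 h3 h4 => hD.convex ha hb h1 h2 h3 h4
    box_mem := fun i l h1 h2 => hsub i (hbox' i l h1 h2).1
    content_box := fun i l h1 h2 => (hbox' i l h1 h2).2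
    exists_box := ?_
    box_inj := ?_
    box_succ := ?_
    lt_q_of_next_mem := ?_ }, fun i => ?_⟩
  · intro b hb
    obtain ⟨-, ⟨⟨i, rfl⟩, hbi⟩, -⟩ := hP.2.1 b hb
    have h1 := (hcont i).2.1 b hbi
    have h2 := hpb i
    have h3 := hqb i
    have h4 : off + ((boxContent b - off).toNat : ℤ) = boxContent b := by omega
    refine ⟨i, (boxContent b - off).toNat, ?_, ?_, ?_⟩
    · simp only
      omega
    · simp only
      omega
    · rw [h4]
      obtain ⟨h5, h6⟩ := hbox i _ h1.1 h1.2
      exact (hstrip i).eq_of_boxContent_eq h5 hbi h6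
  · intro i j l hi hi' hj hj' h
    have h1 := (hbox' i l hi hi').1
    have h2 := (hbox' j l hj hj').1
    rw [← h] at h2
    exact hθinj ((hP.2.1 _ (hsub i h1)).unique ⟨⟨i, rfl⟩, h1⟩ ⟨⟨j, rfl⟩, h2⟩)
  · intro i l hi hi'
    obtain ⟨h1, h2⟩ := hbox' i l hi (le_of_lt hi')
    obtain ⟨h3, h4⟩ := hbox' i (l + 1) (Nat.le_succ_of_le hi) hi'
    refine (hstrip i).eq_of_boxContent_eq h3 (hT.next_mem hP ⟨i, rfl⟩ h1 h2 (hsub i h3)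
      (by push_cast at *; omega) (Or.inr fun hend => ?_)) ?_
    · have := (hstrip i).le_of_isEndBox hend h3
      push_cast at *
      omega
    · rw [boxContent_nextBox]
      push_cast at *
      omega
  · intro i l hi hi' hn
    obtain ⟨h1, h2⟩ := hbox' i l hi hi'
    have h3 := hT.next_mem hP ⟨i, rfl⟩ h1 h2 hn (boxContent_nextBox _ _) (Or.inl hn)
    have h4 := (hcont i).2.1 _ h3
    rw [boxContent_nextBox] at h4
    simp only
    omega
  · have := hpb i
    have := hqb i
    simp only
    omega

/-- A segment of a border strip is a strip decomposition with a single strip. -/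
theorem exists_stripDecomposition_segment {T : Set Box} (hT : IsBorderStrip T) {p q off : ℤ}
    {L : ℕ} (hpq : p ≤ q) (hp : off < p) (hq : q < off + L)
    (hTc : ∀ c, p ≤ c → c ≤ q → ∃ b ∈ T, boxContent b = c)
    {D : Finset Box} (hD : (D : Set Box) = stripSegment T p q) :
    ∃ S : StripDecomposition Unit L D (stripUp T off) off,
      off + (S.p () : ℕ) = p ∧ off + (S.q () : ℕ) = q := by
  have hmem : ∀ b, b ∈ D ↔ b ∈ T ∧ p ≤ boxContent b ∧ boxContent b ≤ q := by
    intro b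
    rw [← Finset.mem_coe, hD]
    rfl
  have hbox : ∀ l : ℕ, (p - off).toNat ≤ l → l ≤ (q - off).toNat →
      boxAt T (off + l) ∈ T ∧ boxContent (boxAt T (off + l)) = off + l :=
    fun l h1 h2 => boxAt_spec (hTc _ (by omega) (by omega))
  have hnext : ∀ (l : ℕ) (b : Box), (p - off).toNat ≤ l → l ≤ (q - off).toNat → b ∈ T →
      boxContent b = off + l + 1 → b = nextBox (stripUp T off l) (boxAt T (off + l)) := by
    intro l b h1 h2 hb hbc
    obtain ⟨h3, h4⟩ := hbox l h1 h2
    refine hT.eq_of_boxContent_eq hb (hT.nextBox_stripUp_mem h3 h4 hb (by omega)) ?_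
    rw [boxContent_nextBox]
    omega
  refine ⟨{
    p := fun _ => ⟨(p - off).toNat, by omega⟩
    q := fun _ => ⟨(q - off).toNat, by omega⟩
    box := fun _ l => boxAt T (off + l)
    p_pos := fun _ => by simp only; omega
    p_le_q := fun _ => Fin.mk_le_mk.2 (by omega)
    p_inj := fun _ _ _ => rfl
    q_inj := fun _ _ _ => rfl
    convex := ?_
    box_mem := ?_
    content_box := fun _ l h1 h2 => (hbox l h1 h2).2
    exists_box := ?_
    box_inj := fun _ _ _ _ _ _ _ _ => rfl
    box_succ := ?_
    lt_q_of_next_mem := ?_ }, ?_⟩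
  · intro a ha b hb e h1 h2 h3 h4
    rw [hmem] at *
    refine ⟨hT.2.1.convex ha.1 hb.1 h1 h2 h3 h4, ?_⟩
    have := hT.eq_or_eq_of_le ha.1 hb.1 (h1.trans h2) (h3.trans h4)
    simp only [boxContent] at *
    omega
  · intro _ l h1 h2
    obtain ⟨h3, h4⟩ := hbox l h1 h2
    simp only at h1 h2
    rw [hmem]
    exact ⟨h3, by omega, by omega⟩
  · intro b hb
    rw [hmem] at hb
    have h4 : off + ((boxContent b - off).toNat : ℤ) = boxContent b := by omega
    have h5 : (p - off).toNat ≤ (boxContent b - off).toNat := by omega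
    have h6 : (boxContent b - off).toNat ≤ (q - off).toNat := by omega
    refine ⟨(), _, h5, h6, ?_⟩
    obtain ⟨h7, h8⟩ := hbox _ h5 h6
    exact hT.eq_of_boxContent_eq h7 hb.1 (h8.trans h4)
  · intro _ l h1 h2
    obtain ⟨h3, h4⟩ := hbox (l + 1) (Nat.le_succ_of_le h1) h2
    exact hnext l _ h1 (le_of_lt h2) h3 (by push_cast at *; omega)
  · intro _ l h1 h2 hn
    obtain ⟨h3, h4⟩ := hbox l h1 h2
    rw [hmem, boxContent_nextBox] at hn
    simp only
    omega
  · simp only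
    omega

theorem isSSYT_coe_extendZero_iff {N : ℕ} [NeZero N] {D : Finset Box} (t : D → Fin N) :
    IsSSYT D (fun b => (extendZero t b : ℕ)) ↔ IsTableau D (extendZero t) := by
  refine ⟨fun h => ⟨h.1, h.2.1⟩, fun h => ⟨h.1, h.2, fun b hb => ?_⟩⟩
  simp only
  rw [extendZero, dif_neg (by simpa using hb), Fin.val_zero]

theorem ncard_extendZero_eq {N : ℕ} [NeZero N] {D : Finset Box} (t : D → Fin N) (k : Fin N) :
    {b ∈ (D : Set Box) | (extendZero t b : ℕ) = k}.ncard =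
      (∑ b : D, Finsupp.single (t b) 1 : Fin N →₀ ℕ) k := by
  classical
  have h1 : {b ∈ (D : Set Box) | (extendZero t b : ℕ) = k} =
      ((D.filter fun b => extendZero t b = k : Finset Box) : Set Box) := by
    ext b
    simp [Fin.val_inj]
  rw [h1, Set.ncard_coe_finset, Finset.card_filter, ← Finset.sum_coe_sort, Finsupp.finsetSum_apply]
  refine Finset.sum_congr rfl fun b _ => ?_
  rw [extendZero_coe, Finsupp.single_apply]

open Finset Classical in
/-- The skew Schur function, restricted to the first `N` variables, enumerates the tableaux with
entries less than `N`. -/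
theorem killCompl_schur (N : ℕ) [NeZero N] (D : Finset Box) :
    MvPowerSeries.killCompl (R := ℤ) (Fin.valEmbedding (n := N)) (schur D) =
      ∑ t : D → Fin N with IsTableau D (extendZero t),
        ∏ b, MvPowerSeries.X (Fin.ofNat N (t b)) := by
  ext x
  rw [MvPowerSeries.coeff_killCompl, map_sum]
  have hprod : ∀ t : D → Fin N, ∏ b, MvPowerSeries.X (R := ℤ) (Fin.ofNat N (t b)) =
      MvPowerSeries.monomial (∑ b : D, Finsupp.single (t b) 1 : Fin N →₀ ℕ) 1 := by
    intro t
    simp only [Fin.ofNat_val_eq_self, MvPowerSeries.X_def, MvPowerSeries.prod_monomial, prod_const_one]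
  simp only [hprod, MvPowerSeries.coeff_monomial]
  rw [← sum_filter, sum_const, filter_filter]
  have hinj : Function.Injective fun (t : D → Fin N) (b : Box) => (extendZero t b : ℕ) := by
    intro t t' h
    funext b
    have := congrFun h b
    simp only [extendZero_coe] at this
    exact Fin.ext this
  have hset : {T : Box → ℕ | IsSSYT D T ∧ ∀ n : ℕ, Finsupp.embDomain Fin.valEmbedding x n =
      {b ∈ (D : Set Box) | T b = n}.ncard} = (fun (t : D → Fin N) (b : Box) => (extendZero t b : ℕ)) ''
      (({t : D → Fin N | IsTableau D (extendZero t) ∧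
        x = ∑ b : D, Finsupp.single (t b) 1} : Finset (D → Fin N)) : Set (D → Fin N)) := by
    ext T
    simp only [Set.mem_ofPred_eq, coe_filter, mem_univ, true_and, Set.mem_image]
    constructor
    · rintro ⟨hT, hcount⟩
      have hlt : ∀ b ∈ D, T b < N := by
        intro b hb
        by_contra hge
        have h1 := hcount (T b)
        rw [Finsupp.embDomain_of_notMem_range _ _ _ (by rintro ⟨k, hk⟩; exact hge (hk ▸ k.2))] at h1
        have hfin : {c ∈ (D : Set Box) | T c = T b}.Finite := D.finite_toSet.subset fun c hc => hc.1
        have := (Set.ncard_eq_zero hfin).1 h1.symm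
        exact (this.subset ⟨hb, rfl⟩ : b ∈ (∅ : Set Box))
      have hext : (fun b => (extendZero (fun b : D => (⟨T b, hlt b b.2⟩ : Fin N)) b : ℕ)) = T := by
        funext b
        by_cases hb : b ∈ D
        · rw [extendZero_of_mem _ hb]
        · rw [extendZero, dif_neg hb, Fin.val_zero, hT.2.2 b (by simpa using hb)]
      refine ⟨fun b => ⟨T b, hlt b b.2⟩, ⟨?_, ?_⟩, hext⟩
      · rw [← isSSYT_coe_extendZero_iff, hext]
        exact hT
      · ext k
        rw [← ncard_extendZero_eq, ← Finsupp.embDomain_apply_self Fin.valEmbedding x k]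
        simp only [congrFun hext]
        exact hcount k
    · rintro ⟨t, ⟨ht, rfl⟩, rfl⟩
      refine ⟨(isSSYT_coe_extendZero_iff t).2 ht, fun n => ?_⟩
      by_cases hn : n < N
      · rw [ncard_extendZero_eq t ⟨n, hn⟩]
        exact Finsupp.embDomain_apply_self Fin.valEmbedding _ ⟨n, hn⟩
      · rw [Finsupp.embDomain_of_notMem_range _ _ _ (by rintro ⟨k, hk⟩; exact hn (hk ▸ k.2))]
        have : {b ∈ (D : Set Box) | (extendZero t b : ℕ) = n} = ∅ :=
          Set.eq_empty_of_forall_notMem fun b hb => hn (hb.2 ▸ (extendZero t b).2)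
        rw [this, Set.ncard_empty]
  have : MvPowerSeries.coeff (Finsupp.embDomain Fin.valEmbedding x) (schur D) = (({T : Box → ℕ |
      IsSSYT D T ∧ ∀ n : ℕ, Finsupp.embDomain Fin.valEmbedding x n =
      {b ∈ (D : Set Box) | T b = n}.ncard}.ncard : ℕ) : ℤ) := rfl
  rw [this, hset, Set.ncard_image_of_injective _ hinj, Set.ncard_coe_finset]
  simp

/-- A power series is determined by its restrictions to finitely many variables. -/
theorem eq_of_killCompl_eq {f g : MvPowerSeries ℕ ℤ}
    (h : ∀ (N : ℕ) [NeZero N], MvPowerSeries.killCompl (R := ℤ) (Fin.valEmbedding (n := N)) f =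
      MvPowerSeries.killCompl (R := ℤ) (Fin.valEmbedding (n := N)) g) : f = g := by
  ext μ
  obtain ⟨n, hn⟩ := μ.support.exists_nat_subset_range
  obtain ⟨x, hx⟩ : μ ∈ Set.range (Finsupp.embDomain (M := ℕ) (Fin.valEmbedding (n := n + 1))) := by
    rw [Finsupp.mem_range_embDomain_iff]
    intro k hk
    have := Finset.mem_range.1 (hn hk)
    exact ⟨⟨k, by omega⟩, rfl⟩
  rw [← hx, ← MvPowerSeries.coeff_killCompl, h, MvPowerSeries.coeff_killCompl]

open Finset in
theorem sign_eq_neg_one_pow_card {m : ℕ} (σ : Equiv.Perm (Fin m)) :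
    ((σ.sign : ℤˣ) : ℤ) =
      (-1) ^ (univ.filter fun x : Fin m × Fin m => x.2 < x.1 ∧ σ x.1 < σ x.2).card := by
  rw [σ.sign_eq_prod_prod_Iio, ← prod_const, prod_filter, Fintype.prod_prod_type,
    Units.coe_prod]
  refine prod_congr rfl fun j _ => ?_
  rw [Units.coe_prod, ← prod_filter_mul_prod_filter_not univ (fun i => i < j)]
  have h1 : univ.filter (fun i => i < j) = Iio j := by ext; simp
  rw [h1]
  rw [prod_eq_one (s := univ.filter fun i => ¬ i < j) fun i hi => if_neg fun h =>
    (mem_filter.1 hi).2 h.1, mul_one]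
  refine prod_congr rfl fun i hi => ?_
  have hij := mem_Iio.1 hi
  have hne : σ i ≠ σ j := fun h => hij.ne (σ.injective h)
  by_cases h : σ i < σ j
  · simp [h, h.not_gt]
  · simp [h, hij, lt_of_le_of_ne (not_lt.1 h) hne.symm]

/-- The inversion number of an outside decomposition gives the sign of the permutation sorting the
starting contents. -/
theorem neg_one_pow_invOD {m : ℕ} {θ : Fin m → Set Box} (hθinj : Function.Injective θ)
    (hθ : ∀ i, IsBorderStrip (θ i)) {pθ qθ : Fin m → ℤ} (hpq : ∀ i, HasPQ (θ i) (pθ i) (qθ i))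
    (hq : StrictAnti qθ) {τ : Equiv.Perm (Fin m)} (hp : StrictAnti (pθ ∘ τ)) :
    (-1 : ℤ) ^ invOD (Set.range θ) = (τ.sign : ℤˣ) := by
  rw [← Equiv.Perm.sign_inv, sign_eq_neg_one_pow_card, ← Set.ncard_coe_finset,
    ← Set.ncard_image_of_injective _ (hθinj.prodMap hθinj), invOD]
  congr 2
  have hpτ : ∀ i j, pθ j < pθ i ↔ τ⁻¹ i < τ⁻¹ j := by
    intro i j
    rw [← hp.lt_iff_gt]
    simp only [Function.comp_apply, ← Equiv.Perm.mul_apply, mul_inv_cancel, Equiv.Perm.one_apply]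
  ext ⟨A, B⟩
  simp only [Set.mem_ofPred_eq, Finset.coe_filter, Finset.mem_univ, true_and, Set.mem_image,
    Prod.exists, Prod.map_apply, Prod.mk.injEq]
  constructor
  · rintro ⟨⟨i, rfl⟩, ⟨j, rfl⟩, p₁, q₁, p₂, q₂, h1, h2, h3, h4⟩
    obtain ⟨rfl, rfl⟩ := (hθ i).hasPQ_unique h1 (hpq i)
    obtain ⟨rfl, rfl⟩ := (hθ j).hasPQ_unique h2 (hpq j)
    exact ⟨i, j, ⟨hq.lt_iff_gt.1 h4, (hpτ i j).1 h3⟩, rfl, rfl⟩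
  · rintro ⟨i, j, ⟨h1, h2⟩, rfl, rfl⟩
    exact ⟨⟨i, rfl⟩, ⟨j, rfl⟩, _, _, _, _, hpq i, hpq j, (hpτ i j).2 h2, hq h1⟩

/-- The ribbon Schur function of a segment of a border strip, restricted to the first `N`
variables, is the generating function of the paths along it. -/
theorem killCompl_schur_stripSegment {T : Set Box} (hT : IsBorderStrip T) (hTfin : T.Finite)
    {off : ℤ} {L : ℕ} {p q : Fin L} (hp : 0 < (p : ℕ))
    (hTc : ∀ c, off + (p : ℕ) ≤ c → c ≤ off + (q : ℕ) → ∃ b ∈ T, boxContent b = c)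
    (N : ℕ) [NeZero N] :
    MvPowerSeries.killCompl (R := ℤ) (Fin.valEmbedding (n := N))
        (if off + (p : ℕ) ≤ off + (q : ℕ) + 1 then
          schur (stripSegment T (off + (p : ℕ)) (off + (q : ℕ))) else 0) =
      ribbonGF (stripUp T off) (fun n => MvPowerSeries.X (Fin.ofNat N n)) N p q := by
  classical
  have hfin : (stripSegment T (off + (p : ℕ)) (off + (q : ℕ))).Finite :=
    hTfin.subset fun b hb => hb.1
  rcases le_or_gt p q with hle | hlt
  · have hle' : (p : ℕ) ≤ q := hle
    have hqL := q.2
    obtain ⟨S, hSp, hSq⟩ := exists_stripDecomposition_segment hT (L := L) (off := off)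
      (by omega) (by omega) (by omega) hTc hfin.coe_toFinset
    have ep : S.p () = p := Fin.ext (by omega)
    have eq : S.q () = q := Fin.ext (by omega)
    rw [if_pos (by omega)]
    conv_lhs => rw [← hfin.coe_toFinset]
    rw [killCompl_schur, S.sum_isTableau_eq_det fun n => MvPowerSeries.X (Fin.ofNat N n),
      Matrix.det_unique]
    simp only [Matrix.of_apply]
    exact congrArg₂ _ ep eq
  · have hlt' : (q : ℕ) < p := hlt
    rw [ribbonGF_of_gt _ _ hlt]
    by_cases h : (p : ℕ) = q + 1
    · have hempty : stripSegment T (off + (p : ℕ)) (off + (q : ℕ)) = ((∅ : Finset Box) : Set Box) := by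
        rw [Finset.coe_empty]
        refine Set.eq_empty_of_forall_notMem fun b hb => ?_
        have := hb.2
        omega
      rw [if_pos (by omega), if_pos h, hempty, killCompl_schur, Finset.filter_true_of_mem]
      · simp
      · intro t _
        exact ⟨by simp, by simp⟩
    · rw [if_neg (by omega), if_neg h, map_zero]
/-- **Hamel–Goulden determinant.** For an outside decomposition
`Π = (θ_1, …, θ_m)` of an edgewise connected skew diagram `D`, ordered so that the ending
contents `q(θ_i)` strictly decrease, with `p_1 > ⋯ > p_m` the decreasing rearrangement of
the starting contents and `φ` the cutting strip,
`s_D = (-1)^{inv(Π)} · det( s_{φ[p_j, q(θ_i)]} )`, where an entry with `p_j > q(θ_i) + 1`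
is `0` and `φ[q+1, q] = ∅` gives the entry `1`. -/
theorem hamel_goulden
    (D : Set Box) (hD : IsSkewShape D) (hne : D.Nonempty) (hconn : EdgewiseConnected D)
    (m : ℕ) (θ : Fin m → Set Box) (hθinj : Function.Injective θ)
    (hP : IsOutsideDecomposition D (Set.range θ))
    (pθ qθ : Fin m → ℤ) (hpq : ∀ i : Fin m, HasPQ (θ i) (pθ i) (qθ i))
    (hqmono : ∀ i j : Fin m, i < j → qθ j < qθ i)
    (p : Fin m → ℤ) (hpmono : ∀ i j : Fin m, i < j → p j < p i)
    (hperm : ∃ τ : Equiv.Perm (Fin m), p = pθ ∘ τ)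
    (T : Set Box) (hT : IsCuttingStripOf D (Set.range θ) T) :
    schur D = (-1 : MvPowerSeries ℕ ℤ) ^ invOD (Set.range θ) *
      Matrix.det (Matrix.of fun i j : Fin m =>
        if p j ≤ qθ i + 1 then schur (stripSegment T (p j) (qθ i)) else 0) := by
  obtain ⟨τ, rfl⟩ := hperm
  have hstrip : ∀ i, IsBorderStrip (θ i) := fun i => (hP.1 _ ⟨i, rfl⟩).1
  have hsign : (-1 : MvPowerSeries ℕ ℤ) ^ invOD (Set.range θ) = ((τ.sign : ℤˣ) : ℤ) := by
    rw [← neg_one_pow_invOD hθinj hstrip hpq hqmono hpmono]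
    push_cast
    rfl
  obtain ⟨E, rfl⟩ := hD.finite.exists_finset_coe
  have hpinj : Function.Injective pθ := by
    have : pθ = (pθ ∘ τ) ∘ τ.symm := by
      ext i
      simp
    rw [this]
    exact (StrictAnti.injective hpmono).comp τ.symm.injective
  obtain ⟨K, hK⟩ : ∃ K : ℕ, ∀ b ∈ E, (boxContent b).natAbs < K :=
    ⟨E.sup (fun b => (boxContent b).natAbs) + 1, fun b hb =>
      Nat.lt_succ_of_le (Finset.le_sup (f := fun b => (boxContent b).natAbs) hb)⟩
  obtain ⟨S, hS⟩ := exists_stripDecomposition hD.isSkewLike hθinj hP hpq hpinj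
    (StrictAnti.injective hqmono) hT (off := -K) (L := 2 * K) fun b hb => by
      have := hK b hb
      omega
  have hTfin : T.Finite := Set.Finite.of_finite_image (f := boxContent)
    (hT.2.1 ▸ E.finite_toSet.image _) fun a ha b hb h => hT.1.eq_of_boxContent_eq ha hb h
  have hmemT : ∀ i, ∀ b ∈ θ i, ∃ t ∈ T, boxContent t = boxContent b := by
    intro i b hb
    have : boxContent b ∈ boxContent '' T := by
      rw [hT.2.1]
      exact ⟨b, (hP.1 _ ⟨i, rfl⟩).2 hb, rfl⟩
    exact this
  refine eq_of_killCompl_eq fun N _ => ?_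
  rw [hsign, map_mul, map_intCast, AlgHom.map_det, killCompl_schur,
    S.sum_isTableau_eq_det fun n => MvPowerSeries.X (Fin.ofNat N n)]
  set A := Matrix.of fun j i => ribbonGF (stripUp T (-K))
    (fun n => MvPowerSeries.X (R := ℤ) (Fin.ofNat N n)) N (S.p j) (S.q i)
  have hM : (MvPowerSeries.killCompl (R := ℤ) (Fin.valEmbedding (n := N))).mapMatrix
      (Matrix.of fun i j : Fin m => if (pθ ∘ τ) j ≤ qθ i + 1 then
        schur (stripSegment T ((pθ ∘ τ) j) (qθ i)) else 0) = A.transpose.submatrix id τ := by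
    ext1 i j
    simp only [AlgHom.mapMatrix_apply, Matrix.map_apply, Matrix.of_apply, Matrix.submatrix_apply,
      Matrix.transpose_apply, id_eq, A, Function.comp_apply]
    rw [← (hS (τ j)).1, ← (hS i).2]
    refine killCompl_schur_stripSegment hT.1 hTfin (S.p_pos _) (fun c h1 h2 => ?_) N
    rw [(hS (τ j)).1] at h1
    rw [(hS i).2] at h2
    obtain ⟨⟨a, ha, hac⟩, -⟩ := hpq (τ j)
    obtain ⟨-, b, hb, hbc⟩ := hpq i
    obtain ⟨t, ht, htc⟩ := hmemT _ a ha.1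
    obtain ⟨t', ht', htc'⟩ := hmemT _ b hb.1
    exact hT.1.exists_of_le ht ht' (by omega) (by omega)
  rw [hM, Matrix.det_permute', Matrix.det_transpose, ← mul_assoc, ← Int.cast_mul,
    Int.units_coe_mul_self, Int.cast_one, one_mul]
end
end
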